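/- Let 1 ≤ R < ∞ and let f be a transcendental meromorphic function in the plane such that all finite critical and asymptotic values w of f satisfy |w| ≤ R. Let U be a component of the set {z ∈ ℂ : |f(z)| > R} which contains no poles of f, and let z₀ ∈ ℂ \ U. Then for all z ∈ U: (log(|f(z)|/R))² ≤ T(z), where T(z) = 32π²|(z−z₀)² S_f(z)| + 16π² + 12, and moreover χ(f(z), ∞) ≥ (1/(2R)) exp(−√(T(z))) ≥ (1/R) exp(−20|z−z₀|√(|S_f(z)|) − 20). -/

import Mathlib

open Filter Set Topology Bornology MeasureTheory

noncomputable section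

/-! ### The extended plane and the chordal metric

ℂ∞ is modelled as `Option ℂ`, with `none` denoting the point ∞. -/

/-- The chordal metric χ on the extended complex plane ℂ∞ (`none` = ∞). -/
def chordal : Option ℂ → Option ℂ → ℝ
  | Option.none, Option.none => 0
  | Option.none, Option.some w => 1 / Real.sqrt (1 + norm w ^ 2)
  | Option.some z, Option.none => 1 / Real.sqrt (1 + norm z ^ 2)
  | Option.some z, Option.some w =>
      norm (z - w) / Real.sqrt ((1 + norm z ^ 2) * (1 + norm w ^ 2))

/-! ### Meromorphic functions in the plane -/

/-- `f` is meromorphic on the plane with pole set `P`: poles form a discrete closed set,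
`f` is analytic off `P`, and `|f| → ∞` at each point of `P`. -/
def MeroPlane (f : ℂ → ℂ) (P : Set ℂ) : Prop :=
  (∀ K : Set ℂ, IsCompact K → (P ∩ K).Finite) ∧
  (∀ z ∉ P, AnalyticAt ℂ f z) ∧
  ∀ p ∈ P, Tendsto (fun z => norm (f z)) (nhdsWithin p Pᶜ) atTop

/-- `f` coincides with a rational function away from its poles. -/
def RationalFn (f : ℂ → ℂ) (P : Set ℂ) : Prop :=
  ∃ p q : Polynomial ℂ, q ≠ 0 ∧ ∀ z ∉ P, q.eval z ≠ 0 → f z = p.eval z / q.eval z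

/-- `f` is a transcendental meromorphic function in the plane, with pole set `P`. -/
def TranscMeroPlane (f : ℂ → ℂ) (P : Set ℂ) : Prop :=
  MeroPlane f P ∧ ¬ RationalFn f P

/-- `f` has a pole of order `m` at `z₀`. -/
def PoleOrder (f : ℂ → ℂ) (z₀ : ℂ) (m : ℕ) : Prop :=
  0 < m ∧ ∃ g : ℂ → ℂ, AnalyticAt ℂ g z₀ ∧ g z₀ ≠ 0 ∧
    ∀ᶠ z in nhdsWithin z₀ {z₀}ᶜ, f z = g z / (z - z₀) ^ m

/-- `f` has a zero of order `m` at `z₀`. -/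
def ZeroOrder (f : ℂ → ℂ) (z₀ : ℂ) (m : ℕ) : Prop :=
  0 < m ∧ ∃ g : ℂ → ℂ, AnalyticAt ℂ g z₀ ∧ g z₀ ≠ 0 ∧
    ∀ᶠ z in nhds z₀, f z = (z - z₀) ^ m * g z

/-- `z₀` is a multiple point of `f` of multiplicity `μ`: either a pole of `f` of order `μ ≥ 2`,
or a point of analyticity where `f'` has a zero of order `μ - 1`. -/
def MultiplePointWithMult (f : ℂ → ℂ) (z₀ : ℂ) (μ : ℕ) : Prop :=
  2 ≤ μ ∧ (PoleOrder f z₀ μ ∨ (AnalyticAt ℂ f z₀ ∧ ZeroOrder (deriv f) z₀ (μ - 1)))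

/-- `z₀` is a multiple point of `f`. -/
def MultiplePoint (f : ℂ → ℂ) (z₀ : ℂ) : Prop :=
  ∃ μ, MultiplePointWithMult f z₀ μ

open scoped Classical in
/-- The value of `f` at `z` as an element of ℂ∞, given the pole set `P`. -/
def valueAt (f : ℂ → ℂ) (P : Set ℂ) (z : ℂ) : Option ℂ :=
  if z ∈ P then none else some (f z)

/-- The set of critical values of `f` in ℂ∞ (values at multiple points). -/
def CriticalValues (f : ℂ → ℂ) (P : Set ℂ) : Set (Option ℂ) :=
  {w | ∃ z, MultiplePoint f z ∧ w = valueAt f P z}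

/-! ### Transcendental singularities of the inverse function -/

/-- A path tending to infinity on which `f → a`; such a path determines a transcendental
singularity of `f⁻¹` over `a`. -/
def AsymptoticPath (f : ℂ → ℂ) (P : Set ℂ) (a : Option ℂ) (γ : ℝ → ℂ) : Prop :=
  ContinuousOn γ (Ici 0) ∧
  Tendsto (fun t => norm (γ t)) atTop atTop ∧
  Tendsto (fun t => chordal (valueAt f P (γ t)) a) atTop (nhds 0)

/-- `C` is a connected component of the set `S`. -/
def IsComponentOf (C S : Set ℂ) : Prop :=
  ∃ x ∈ S, C = connectedComponentIn S x

/-- The paths `γ₁`, `γ₂`, with asymptotic values `a₁`, `a₂` respectively, determine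
distinct transcendental singularities of `f⁻¹`. -/
def DistinctSingularities (f : ℂ → ℂ) (P : Set ℂ) (a₁ a₂ : Option ℂ) (γ₁ γ₂ : ℝ → ℂ) : Prop :=
  a₁ ≠ a₂ ∨ ∃ t : ℝ, 0 < t ∧ ∃ C₁ C₂ : Set ℂ,
    IsComponentOf C₁ {z | chordal (valueAt f P z) a₁ < t} ∧
    IsComponentOf C₂ {z | chordal (valueAt f P z) a₂ < t} ∧
    Disjoint C₁ C₂ ∧
    IsBounded (γ₁ '' Ici 0 \ C₁) ∧ IsBounded (γ₂ '' Ici 0 \ C₂)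

/-- The inverse function of `f` has finitely many transcendental singularities: there is a
bound `n` on the size of any family of pairwise distinct transcendental singularities. -/
def FinitelyManyTranscSing (f : ℂ → ℂ) (P : Set ℂ) : Prop :=
  ∃ n : ℕ, ∀ m : ℕ, ∀ a : Fin m → Option ℂ, ∀ γ : Fin m → ℝ → ℂ,
    (∀ i, AsymptoticPath f P (a i) (γ i)) →
    (∀ i j, i ≠ j → DistinctSingularities f P (a i) (a j) (γ i) (γ j)) →
    m ≤ n

/-- The Schwarzian derivative `S_f = f'''/f' - (3/2)(f''/f')²`. -/
def schwarzian (f : ℂ → ℂ) (z : ℂ) : ℂ :=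
  deriv (deriv (deriv f)) z / deriv f z - (3 / 2) * (deriv (deriv f) z / deriv f z) ^ 2

/-- `w` is a singular value of `f⁻¹`: a critical value or an asymptotic value of `f`. -/
def SingularValue (f : ℂ → ℂ) (P : Set ℂ) (w : Option ℂ) : Prop :=
  w ∈ CriticalValues f P ∨ ∃ γ : ℝ → ℂ, AsymptoticPath f P w γ

/-! ### Nevanlinna theory -/

open scoped Classical in
/-- The order of the pole of `f` at `z` (junk value `0` if there is no pole). -/
def poleOrderAt (f : ℂ → ℂ) (z : ℂ) : ℕ :=
  if h : ∃ m, PoleOrder f z m then h.choose else 0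

/-- `n(t, f)`: the number of poles of `f` of modulus at most `t`, counted with multiplicity. -/
def nCount (f : ℂ → ℂ) (t : ℝ) : ℕ :=
  ∑ᶠ z ∈ {w : ℂ | norm w ≤ t}, poleOrderAt f z

/-- `N(r, f)`: the integrated counting function of the poles of `f`. -/
def nevN (f : ℂ → ℂ) (r : ℝ) : ℝ :=
  (nCount f 0 : ℝ) * Real.log r + ∫ t in (0:ℝ)..r, ((nCount f t : ℝ) - (nCount f 0 : ℝ)) / t

/-- `m(r, f)`: the Nevanlinna proximity function. -/
def nevm (f : ℂ → ℂ) (r : ℝ) : ℝ :=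
  (1 / (2 * Real.pi)) * ∫ θ in (0:ℝ)..(2 * Real.pi),
    Real.log (max 1 (norm (f (r * Complex.exp (θ * Complex.I)))))

/-- `T(r, f)`: the Nevanlinna characteristic. -/
def nevT (f : ℂ → ℂ) (r : ℝ) : ℝ := nevm f r + nevN f r

/-- The order of growth `ρ(f) = limsup_{r→∞} log T(r,f)/log r`, as an extended real. -/
def growthOrder (f : ℂ → ℂ) : EReal :=
  Filter.limsup (fun r : ℝ => ((Real.log (nevT f r) / Real.log r : ℝ) : EReal)) atTop

/-- ∞ is a Borel exceptional value of `f`. -/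
def BorelExceptionalInfty (f : ℂ → ℂ) : Prop :=
  Filter.limsup (fun r : ℝ => ((Real.log (nevN f r) / Real.log r : ℝ) : EReal)) atTop <
  Filter.limsup (fun r : ℝ => ((Real.log (nevT f r) / Real.log r : ℝ) : EReal)) atTop

/-! ### Meromorphic functions near infinity and the Wiman-Valiron property -/

/-- `A` is meromorphic in `R ≤ |z| < ∞` with pole set `P`. -/
def MeroAnnulus (A : ℂ → ℂ) (R : ℝ) (P : Set ℂ) : Prop :=
  P ⊆ {z : ℂ | R ≤ norm z} ∧
  (∀ K : Set ℂ, IsCompact K → (P ∩ K).Finite) ∧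
  (∀ z : ℂ, R < norm z → z ∉ P → AnalyticAt ℂ A z) ∧
  ∀ p ∈ P, Tendsto (fun z => norm (A z)) (nhdsWithin p Pᶜ) atTop

/-- `A` (meromorphic near ∞ with pole set `P`) has an essential singularity at infinity:
it is not the case that the poles are bounded and `A(z) ~ c zⁿ` as `z → ∞`. -/
def EssSingAtInfty (A : ℂ → ℂ) (P : Set ℂ) : Prop :=
  ¬ (IsBounded P ∧ ∃ (n : ℤ) (c : ℂ), c ≠ 0 ∧
      Tendsto (fun z : ℂ => A z / z ^ n)
        (Filter.comap (fun z : ℂ => norm z) atTop ⊓ Filter.principal Pᶜ) (nhds c))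

/-- The logarithmic rectangle `D(z_r, L)` of Definition 2.1. -/
def WVDisk (z₀ : ℂ) (Nr phir L : ℝ) : Set ℂ :=
  {z : ℂ | ∃ τ : ℂ, z = z₀ * Complex.exp τ ∧
    |τ.re| ≤ L * phir / Nr ∧ |τ.im| ≤ L * phir / Nr}

/-- Data witnessing the Wiman-Valiron property for `A`, meromorphic in `R ≤ |z| < ∞`:
an unbounded set `F1 ⊆ [R,∞)`, functions `N : F1 → [2,∞)`, `phi : F1 → [1,∞)` and points
`zr r` with `|zr r| = r`, such that `N(r) → ∞`, `phi(r)/N(r) → 0`, `phi(r)/log N(r) → ∞`,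
`phi(r) = o(log⁺ |A(zr r)|)`, and `A(z) ~ (z/zr r)^{N(r)} A(zr r)` on `D(zr r, 8)`,
uniformly as `r → ∞` in `F1`.  (For `z = zr r · e^τ` one has `(z/zr r)^{N(r)} = e^{N(r)τ}`.) -/
structure WVData (A : ℂ → ℂ) (R : ℝ) where
  F1 : Set ℝ
  N : ℝ → ℝ
  phi : ℝ → ℝ
  zr : ℝ → ℂ
  F1_sub : F1 ⊆ Ici R
  F1_unbounded : ∀ c : ℝ, ∃ r ∈ F1, c < r
  N_ge : ∀ r ∈ F1, 2 ≤ N r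
  phi_ge : ∀ r ∈ F1, 1 ≤ phi r
  N_tendsto : Tendsto N (atTop ⊓ Filter.principal F1) atTop
  phi_over_N : Tendsto (fun r => phi r / N r) (atTop ⊓ Filter.principal F1) (nhds 0)
  phi_over_logN : Tendsto (fun r => phi r / Real.log (N r)) (atTop ⊓ Filter.principal F1) atTop
  zr_abs : ∀ r ∈ F1, norm (zr r) = r
  phi_small : Tendsto (fun r => phi r / Real.log (max 1 (norm (A (zr r)))))
      (atTop ⊓ Filter.principal F1) (nhds 0)
  approx : ∀ ε : ℝ, 0 < ε → ∀ᶠ r in atTop ⊓ Filter.principal F1, ∀ τ : ℂ,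
      |τ.re| ≤ 8 * phi r / N r → |τ.im| ≤ 8 * phi r / N r →
      norm (A (zr r * Complex.exp τ) - Complex.exp ((N r : ℂ) * τ) * A (zr r))
        ≤ ε * norm (Complex.exp ((N r : ℂ) * τ) * A (zr r))

/-- `A` has the Wiman-Valiron property (Definition 2.1). -/
def HasWVProp (A : ℂ → ℂ) (R : ℝ) : Prop := Nonempty (WVData A R)

/-- The point `w_r = z_r exp(-4 phi(r)/N(r))`. -/
def WVwr {A : ℂ → ℂ} {R : ℝ} (W : WVData A R) (r : ℝ) : ℂ :=
  W.zr r * Complex.exp (((-(4 * W.phi r / W.N r) : ℝ) : ℂ))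

/-- The quantity `Z_r = |2 z_r A(z_r)^{1/2} / (N(r)+2)|`. -/
def WVZr {A : ℂ → ℂ} {R : ℝ} (W : WVData A R) (r : ℝ) : ℝ :=
  2 * r * Real.sqrt (norm (A (W.zr r))) / (W.N r + 2)

/-- The data of an analytic branch `sqA r` of `A^{1/2}` on `D(z_r, 4)` together with the
primitive `Z r` of `A^{1/2}` with `Z r (w_r) = 2 w_r A(w_r)^{1/2}/(N+2)`; this encodes
`Z(z) = 2 w_r A(w_r)^{1/2}/(N+2) + ∫_{w_r}^z A(t)^{1/2} dt`. -/
def IsZData {A : ℂ → ℂ} {R : ℝ} (W : WVData A R) (sqA Z : ℝ → ℂ → ℂ) (r : ℝ) : Prop :=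
  (∀ z ∈ WVDisk (W.zr r) (W.N r) (W.phi r) 4,
      (sqA r z) ^ 2 = A z ∧ AnalyticAt ℂ (sqA r) z ∧ HasDerivAt (Z r) (sqA r z) z) ∧
  Z r (WVwr W r) = 2 * WVwr W r * sqA r (WVwr W r) / ((W.N r : ℂ) + 2)

/-- The closed logarithmic rectangle `J₁ = {Z : |log|Z/Z_r|| ≤ phi(r), |arg Z| ≤ π/4}`. -/
def J1 (Zr phir : ℝ) : Set ℂ :=
  {w : ℂ | w ≠ 0 ∧ |Real.log (norm w / Zr)| ≤ phir ∧ |Complex.arg w| ≤ Real.pi / 4}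

/-! ### ε-sets -/

/-- An ε-set: a countable union of discs `B(b_j, ρ_j)` with `|b_j| → ∞` and
`Σ ρ_j/|b_j| < ∞`. -/
def IsEpsilonSet (E : Set ℂ) : Prop :=
  ∃ (b : ℕ → ℂ) (ρ : ℕ → ℝ), (∀ j, 0 ≤ ρ j) ∧
    Tendsto (fun j => norm (b j)) atTop atTop ∧
    Summable (fun j => ρ j / norm (b j)) ∧
    E = ⋃ j, Metric.ball (b j) (ρ j)


lemma aux_circle (h : ℂ → ℂ) (hd : DifferentiableOn ℂ h (Metric.ball 0 1)) (ρ : ℝ) (h0 : 0 < ρ)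
    (h1 : ρ < 1) :
    2 * Real.pi * (ρ⁻¹ ^ 4 + ‖h 0‖ ^ 2) ≤
      ∫ θ in (-Real.pi)..Real.pi, ‖-((circleMap 0 ρ θ) ^ 2)⁻¹ + h (circleMap 0 ρ θ)‖ ^ 2 := by
  set b := h 0 with hb
  set N : ℂ → ℂ := fun s => (-2 * s ^ 2 + 2 * ρ ^ 4 * (starRingEnd ℂ b)) * h s with hN
  have hsub : Metric.closedBall (0:ℂ) ρ ⊆ Metric.ball 0 1 := Metric.closedBall_subset_ball h1
  have hNd : DifferentiableOn ℂ N (Metric.ball 0 1) := by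
    apply DifferentiableOn.mul _ hd
    fun_prop
  have hmean : Real.circleAverage N 0 ρ = N 0 := by
    apply DiffContOnCl.circleAverage
    rw [abs_of_pos h0]
    apply DifferentiableOn.diffContOnCl
    rw [closure_ball _ h0.ne']
    exact hNd.mono hsub
  have hmem : ∀ θ, circleMap 0 ρ θ ∈ Metric.ball (0:ℂ) 1 := fun θ => by
    simp [abs_of_pos h0, h1]
  have hcont : Continuous (fun θ => h (circleMap 0 ρ θ)) :=
    hd.continuousOn.comp_continuous (continuous_circleMap 0 ρ) hmem
  have hcontN : Continuous (fun θ => N (circleMap 0 ρ θ)) :=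
    hNd.continuousOn.comp_continuous (continuous_circleMap 0 ρ) hmem
  have hint : ∫ θ in (-Real.pi)..Real.pi, N (circleMap 0 ρ θ) = 2 * Real.pi * N 0 := by
    rw [← hmean, Real.circleAverage]
    have := (periodic_circleMap 0 ρ).comp N |>.intervalIntegral_add_eq (-Real.pi) 0
    simp only [Function.comp, neg_add_eq_sub] at this
    rw [show 2 * Real.pi - Real.pi = Real.pi by ring, zero_add] at this
    rw [this, Complex.real_smul]
    push_cast
    field_simp
  have hintre : ∫ θ in (-Real.pi)..Real.pi, (N (circleMap 0 ρ θ)).re = 2 * Real.pi * (2 * ρ ^ 4 * ‖b‖ ^ 2) := by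
    have := Complex.reCLM.intervalIntegral_comp_comm (hcontN.intervalIntegrable (μ := volume) (-Real.pi) Real.pi)
    simp only [Complex.reCLM_apply] at this
    rw [this, hint]
    have : N 0 = ((2 * ρ ^ 4 * ‖b‖ ^ 2 : ℝ) : ℂ) := by
      simp only [hN, ← hb]
      push_cast
      rw [← Complex.conj_mul']
      ring
    rw [this, ← Complex.ofReal_ofNat 2, ← Complex.ofReal_mul, ← Complex.ofReal_mul, Complex.ofReal_re]
  have hne : ∀ θ, circleMap 0 ρ θ ≠ 0 := fun θ => circleMap_ne_center h0.ne'
  have key : ∀ θ, ρ⁻¹ ^ 4 - ‖b‖ ^ 2 + ρ⁻¹ ^ 4 * (N (circleMap 0 ρ θ)).re ≤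
      ‖-((circleMap 0 ρ θ) ^ 2)⁻¹ + h (circleMap 0 ρ θ)‖ ^ 2 := by
    intro θ
    set s := circleMap 0 ρ θ with hs
    have hns : ‖s‖ = ρ := by simp [hs, abs_of_pos h0]
    have e1 : -(s ^ 2)⁻¹ + h s = (s ^ 2)⁻¹ * (-1 + s ^ 2 * h s) := by
      have := hne θ
      rw [← hs] at this
      field_simp
    have e2 : ‖-(s ^ 2)⁻¹ + h s‖ ^ 2 = ρ⁻¹ ^ 4 * ‖-1 + s ^ 2 * h s‖ ^ 2 := by
      rw [e1, norm_mul, norm_inv, norm_pow, hns]; ring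
    rw [e2]
    have e3 : ‖-1 + s ^ 2 * h s‖ ^ 2 = 1 - 2 * (s ^ 2 * h s).re + ρ ^ 4 * ‖h s‖ ^ 2 := by
      have : ρ ^ 4 * ‖h s‖ ^ 2 = ‖s ^ 2 * h s‖ ^ 2 := by
        rw [norm_mul, norm_pow, hns]; ring
      rw [this, Complex.sq_norm, Complex.sq_norm, Complex.normSq_apply, Complex.normSq_apply]
      simp
      ring
    have e4 : 2 * (starRingEnd ℂ b * h s).re - ‖b‖ ^ 2 ≤ ‖h s‖ ^ 2 := by
      have : 0 ≤ ‖h s - b‖ ^ 2 := by positivity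
      rw [Complex.sq_norm, Complex.normSq_apply] at this ⊢
      rw [Complex.sq_norm, Complex.normSq_apply]
      simp at this ⊢
      linarith
    have e5 : (N s).re = -2 * (s ^ 2 * h s).re + 2 * ρ ^ 4 * (starRingEnd ℂ b * h s).re := by
      have : N s = ((-2 : ℝ) : ℂ) * (s ^ 2 * h s) + ((2 * ρ ^ 4 : ℝ) : ℂ) * (starRingEnd ℂ b * h s) := by
        simp only [hN]; push_cast; ring
      rw [this, Complex.add_re, Complex.re_ofReal_mul, Complex.re_ofReal_mul]
    have e6 : ρ⁻¹ ^ 4 * ρ ^ 4 = 1 := by field_simp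
    rw [e3, e5]
    have hp : 0 ≤ ρ ^ 4 := by positivity
    have e7 : 1 - ρ ^ 4 * ‖b‖ ^ 2 + (-2 * (s ^ 2 * h s).re + 2 * ρ ^ 4 * (starRingEnd ℂ b * h s).re)
      ≤ 1 - 2 * (s ^ 2 * h s).re + ρ ^ 4 * ‖h s‖ ^ 2 := by nlinarith
    have hq : 0 ≤ ρ⁻¹ ^ 4 := by positivity
    have := mul_le_mul_of_nonneg_left e7 hq
    refine le_trans (le_of_eq ?_) this
    linear_combination (‖b‖ ^ 2) * e6
  have hcr : Continuous fun θ => (N (circleMap 0 ρ θ)).re := Complex.continuous_re.comp hcontN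
  have : ∫ θ in (-Real.pi)..Real.pi, (ρ⁻¹ ^ 4 - ‖b‖ ^ 2 + ρ⁻¹ ^ 4 * (N (circleMap 0 ρ θ)).re) =
     2 * Real.pi * (ρ⁻¹ ^ 4 + ‖b‖ ^ 2) := by
    rw [intervalIntegral.integral_add (by simp) ((hcr.const_mul _ ).intervalIntegrable _ _)
      |>.trans rfl]
    · rw [intervalIntegral.integral_const_mul, hintre]
      simp
      field_simp
      ring
  rw [← this]
  apply intervalIntegral.integral_mono (by linarith [Real.pi_pos])
  · exact ((continuous_const).add (hcr.const_mul _)).intervalIntegrable _ _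
  · apply Continuous.intervalIntegrable
    have : Continuous fun θ => ((circleMap 0 ρ θ) ^ 2)⁻¹ :=
      ((continuous_circleMap 0 ρ).pow 2).inv₀ (fun θ => pow_ne_zero _ (hne θ))
    exact (this.neg.add hcont).norm.pow 2
  · exact key

lemma aux_det (c : ℂ) : |((ContinuousLinearMap.toSpanSingleton ℂ c).restrictScalars ℝ : ℂ →L[ℝ] ℂ).det| = ‖c‖ ^ 2 := by
  have : ((ContinuousLinearMap.toSpanSingleton ℂ c).restrictScalars ℝ : ℂ →L[ℝ] ℂ).det = ‖c‖ ^ 2 := by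
    simp [ContinuousLinearMap.det, LinearMap.det_restrictScalars, Algebra.norm_complex_eq, Complex.normSq_eq_norm_sq]
  rw [this, abs_of_nonneg (by positivity)]

lemma aux_area_lower (φ : ℂ → ℂ) (hd : DifferentiableOn ℂ φ (Metric.ball 0 1))
    (hinj : InjOn (fun s => s⁻¹ + φ s) (Metric.ball 0 1 \ {0})) (ε r : ℝ) (h0 : 0 < ε)
    (h1 : ε < r) (h2 : r < 1) :
    ENNReal.ofReal (Real.pi * (ε⁻¹ ^ 2 - r⁻¹ ^ 2 + ‖deriv φ 0‖ ^ 2 * (r ^ 2 - ε ^ 2))) ≤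
      volume ((fun s => s⁻¹ + φ s) '' {s : ℂ | ε < ‖s‖ ∧ ‖s‖ < r}) := by
  set A : Set ℂ := {s : ℂ | ε < ‖s‖ ∧ ‖s‖ < r} with hA
  have hAo : IsOpen A := (isOpen_lt continuous_const continuous_norm).inter
    (isOpen_lt continuous_norm continuous_const)
  have hsub : A ⊆ Metric.ball 0 1 \ {0} := by
    intro s hs
    refine ⟨by simpa using hs.2.trans h2, ?_⟩
    rintro rfl
    have := hs.1
    simp at this; linarith
  have hder : ∀ s ∈ A, HasDerivAt (fun s => s⁻¹ + φ s) (-(s ^ 2)⁻¹ + deriv φ s) s := by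
    intro s hs
    have := hsub hs
    exact (hasDerivAt_inv this.2).add
      ((hd.differentiableAt (Metric.isOpen_ball.mem_nhds this.1)).hasDerivAt)
  rw [← lintegral_abs_det_fderiv_eq_addHaar_image volume hAo.measurableSet
    (f' := fun s => (ContinuousLinearMap.toSpanSingleton ℂ (-(s ^ 2)⁻¹ + deriv φ s)).restrictScalars ℝ)
    (fun s hs => ((hder s hs).hasFDerivAt.restrictScalars ℝ).hasFDerivWithinAt) (hinj.mono hsub)]
  simp only [aux_det]
  rw [← lintegral_indicator hAo.measurableSet, ← Complex.lintegral_comp_polarCoord_symm]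
  have hh : DifferentiableOn ℂ (deriv φ) (Metric.ball 0 1) := hd.deriv Metric.isOpen_ball
  set F : ℂ → ENNReal := fun s => ENNReal.ofReal (‖-(s ^ 2)⁻¹ + deriv φ s‖ ^ 2) with hF
  have step : ∀ ρ ∈ Ioo ε r, ENNReal.ofReal (2 * Real.pi * (ρ⁻¹ ^ 3 + ‖deriv φ 0‖ ^ 2 * ρ)) ≤
      ∫⁻ θ in Ioo (-Real.pi) Real.pi, ENNReal.ofReal ρ * F (circleMap 0 ρ θ) := by
    intro ρ hρ
    have hρ0 := h0.trans hρ.1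
    have hρ1 := hρ.2.trans h2
    have := aux_circle _ hh ρ hρ0 hρ1
    have hcont : Continuous (fun θ => ‖-((circleMap 0 ρ θ) ^ 2)⁻¹ + deriv φ (circleMap 0 ρ θ)‖ ^ 2) := by
      have a1 : Continuous (fun θ => deriv φ (circleMap 0 ρ θ)) :=
        hh.continuousOn.comp_continuous (continuous_circleMap 0 ρ) (fun θ => by simp [abs_of_pos hρ0, hρ1])
      have a2 : Continuous fun θ => ((circleMap 0 ρ θ) ^ 2)⁻¹ :=
        ((continuous_circleMap 0 ρ).pow 2).inv₀ (fun θ => pow_ne_zero _ (circleMap_ne_center hρ0.ne'))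
      exact (a2.neg.add a1).norm.pow 2
    rw [lintegral_const_mul' _ _ ENNReal.ofReal_ne_top, hF]
    rw [← ofReal_integral_eq_lintegral_ofReal
      ((hcont.integrableOn_Icc (a := -Real.pi) (b := Real.pi)).mono_set Ioo_subset_Icc_self)
      (by filter_upwards with θ; positivity),
      ← ENNReal.ofReal_mul hρ0.le]
    apply ENNReal.ofReal_le_ofReal
    rw [← integral_Ioc_eq_integral_Ioo, ← intervalIntegral.integral_of_le (by linarith [Real.pi_pos])]
    refine le_trans (le_of_eq ?_) (mul_le_mul_of_nonneg_left this hρ0.le)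
    field_simp
  have hTgt : (Ioo ε r) ×ˢ (Ioo (-Real.pi) Real.pi) ⊆ polarCoord.target := by
    intro p hp
    rw [polarCoord_target]
    exact ⟨h0.trans hp.1.1, hp.2⟩
  have hsymm : ∀ p : ℝ × ℝ, Complex.polarCoord.symm p = circleMap 0 p.1 p.2 := by
    intro p
    rw [Complex.polarCoord_symm_apply, circleMap, Complex.exp_mul_I]
    simp
  calc _ = ∫⁻ ρ in Ioo ε r, ENNReal.ofReal (2 * Real.pi * (ρ⁻¹ ^ 3 + ‖deriv φ 0‖ ^ 2 * ρ)) := by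
        have hc : ContinuousOn (fun ρ : ℝ => 2 * Real.pi * (ρ⁻¹ ^ 3 + ‖deriv φ 0‖ ^ 2 * ρ)) (Icc ε r) := by
          have : ContinuousOn (fun ρ : ℝ => ρ⁻¹) (Icc ε r) :=
            continuousOn_inv₀.mono (fun x hx => (h0.trans_le hx.1).ne')
          fun_prop
        rw [← ofReal_integral_eq_lintegral_ofReal]
        · congr 1
          rw [← integral_Ioc_eq_integral_Ioo, ← intervalIntegral.integral_of_le h1.le]
          rw [intervalIntegral.integral_eq_sub_of_hasDerivAt (f := fun ρ => Real.pi * (-(ρ⁻¹ ^ 2) + ‖deriv φ 0‖ ^ 2 * ρ ^ 2))]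
          · ring
          · intro x hx
            rw [uIcc_of_le h1.le] at hx
            have hx0 : x ≠ 0 := (h0.trans_le hx.1).ne'
            have := ((((hasDerivAt_inv hx0).pow 2).neg.add
              (((hasDerivAt_id x).pow 2).const_mul (‖deriv φ 0‖ ^ 2))).const_mul Real.pi)
            refine this.congr_deriv ?_
            simp
            field_simp
          · apply ContinuousOn.intervalIntegrable
            rwa [uIcc_of_le h1.le]
        · exact (hc.integrableOn_Icc).mono_set Ioo_subset_Icc_self
        · filter_upwards [ae_restrict_mem measurableSet_Ioo] with ρ hρ
          have := h0.trans hρ.1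
          have := Real.pi_pos
          simp only [Pi.zero_apply]
          positivity
    _ ≤ ∫⁻ ρ in Ioo ε r, ∫⁻ θ in Ioo (-Real.pi) Real.pi, ENNReal.ofReal ρ * F (circleMap 0 ρ θ) :=
        setLIntegral_mono' measurableSet_Ioo step
    _ = ∫⁻ p in (Ioo ε r) ×ˢ (Ioo (-Real.pi) Real.pi), ENNReal.ofReal p.1 * F (circleMap 0 p.1 p.2) := by
        rw [Measure.volume_eq_prod, setLIntegral_prod]
        apply AEMeasurable.fun_mul
        · fun_prop
        · apply AEMeasurable.ennreal_ofReal
          apply ContinuousOn.aemeasurable _ (measurableSet_Ioo.prod measurableSet_Ioo)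
          have hcm : Continuous (fun p : ℝ × ℝ => circleMap 0 p.1 p.2) := by
            unfold circleMap; fun_prop
          have a1 : ContinuousOn (fun p : ℝ × ℝ => deriv φ (circleMap 0 p.1 p.2)) ((Ioo ε r) ×ˢ (Ioo (-Real.pi) Real.pi)) := by
            apply hh.continuousOn.comp hcm.continuousOn
            intro p hp
            simp [abs_of_pos (h0.trans hp.1.1), hp.1.2.trans h2]
          have a2 : ContinuousOn (fun p : ℝ × ℝ => ((circleMap 0 p.1 p.2) ^ 2)⁻¹) ((Ioo ε r) ×ˢ (Ioo (-Real.pi) Real.pi)) :=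
            ((hcm.pow 2).continuousOn).inv₀ (fun p hp => pow_ne_zero _ (circleMap_ne_center (h0.trans hp.1.1).ne'))
          exact (a2.neg.add a1).norm.pow 2
    _ = ∫⁻ p in (Ioo ε r) ×ˢ (Ioo (-Real.pi) Real.pi), ENNReal.ofReal p.1 • A.indicator F (Complex.polarCoord.symm p) := by
        apply setLIntegral_congr_fun (measurableSet_Ioo.prod measurableSet_Ioo)
        intro p hp
        have : circleMap 0 p.1 p.2 ∈ A := by
          simp [hA, abs_of_pos (h0.trans hp.1.1), hp.1.1, hp.1.2]
        simp only [hsymm, indicator_of_mem this, smul_eq_mul]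
    _ ≤ _ := lintegral_mono_set hTgt

lemma aux_upper (ψ ψ2 : ℂ → ℂ) (b : ℂ) (C : ℝ) (K : NNReal)
    (h2 : ∀ s ∈ Metric.closedBall (0:ℂ) (1/2), ψ s = b * s + s ^ 2 * ψ2 s)
    (hC : ∀ s ∈ Metric.closedBall (0:ℂ) (1/2), ‖ψ2 s‖ ≤ C)
    (hK : LipschitzOnWith K (fun s => s * ψ s) (Metric.closedBall (0:ℂ) (1/2)))
    (hinj : InjOn (fun s => s⁻¹ + ψ s) (Metric.ball 0 1 \ {0})) (ε r : ℝ) (h0 : 0 < ε)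
    (hε : ε ≤ 1/2) (hεK : ε * K < 1) (h1 : r < 1) :
    (fun s => s⁻¹ + ψ s) '' {s : ℂ | ε < ‖s‖ ∧ ‖s‖ < r} ⊆
      Metric.closedBall 0 (ε⁻¹ + ‖b‖ * ε + C * ε ^ 2) := by
  rintro _ ⟨s, hs, rfl⟩
  by_contra hw
  set M := ε⁻¹ + ‖b‖ * ε + C * ε ^ 2 with hM
  set w := (fun s => s⁻¹ + ψ s) s with hwdef
  have hw' : M < ‖w‖ := by simpa using hw
  have hC0 : 0 ≤ C := (norm_nonneg _).trans (hC 0 (by simp))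
  have hMε : ε⁻¹ ≤ M := by
    have : 0 ≤ ‖b‖ * ε + C * ε ^ 2 := by positivity
    linarith
  have hwpos : 0 < ‖w‖ := lt_of_lt_of_le (by positivity) (hMε.trans hw'.le)
  have hw0 : w ≠ 0 := norm_pos_iff.1 hwpos
  have hwi : ‖w‖⁻¹ ≤ ε := by
    rw [inv_le_comm₀ hwpos h0]; exact hMε.trans hw'.le
  set T : ℂ → ℂ := fun z => w⁻¹ * (1 + z * ψ z) with hT
  have hsub : Metric.closedBall (0:ℂ) ε ⊆ Metric.closedBall 0 (1/2) := Metric.closedBall_subset_closedBall hε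
  have hmaps : MapsTo T (Metric.closedBall 0 ε) (Metric.closedBall 0 ε) := by
    intro z hz
    have hz1 := hsub hz
    have hzn : ‖z‖ ≤ ε := by simpa using hz
    simp only [hT, mem_closedBall_zero_iff, norm_mul, norm_inv]
    rw [inv_mul_le_iff₀ hwpos, h2 z hz1]
    have e1 : ‖1 + z * (b * z + z ^ 2 * ψ2 z)‖ ≤ 1 + ε * (‖b‖ * ε + ε ^ 2 * C) := by
      refine (norm_add_le _ _).trans ?_
      rw [norm_one, norm_mul]
      gcongr
      refine (norm_add_le _ _).trans ?_
      rw [norm_mul, norm_mul, norm_pow]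
      have := hC z hz1
      gcongr
    refine e1.trans ?_
    have : M * ε = 1 + ε * (‖b‖ * ε + ε ^ 2 * C) := by
      rw [hM]; field_simp; ring
    rw [← this]
    gcongr
  have hlip : LipschitzOnWith (⟨ε, h0.le⟩ * K) T (Metric.closedBall 0 ε) := by
    apply LipschitzOnWith.of_dist_le_mul
    intro x hx y hy
    have := hK.dist_le_mul x (hsub hx) y (hsub hy)
    simp only [hT, dist_eq_norm] at this ⊢
    rw [← mul_sub, norm_mul, norm_inv, add_sub_add_left_eq_sub]
    push_cast
    calc _ ≤ ε * (K * ‖x - y‖) := by gcongr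
      _ = _ := by rw [← mul_assoc]; rfl
  have hcontr : ContractingWith (⟨ε, h0.le⟩ * K) (hmaps.restrict T _ _) := by
    refine ⟨?_, ?_⟩
    · rw [← NNReal.coe_lt_coe]; push_cast; exact hεK
    · exact hlip.mapsToRestrict hmaps
  obtain ⟨y, hy, hfix, -⟩ := hcontr.exists_fixedPoint' Metric.isClosed_closedBall.isComplete hmaps
    (x := 0) (by simp [h0.le]) (edist_ne_top _ _)
  have hfix' : w⁻¹ * (1 + y * ψ y) = y := hfix
  have hy0 : y ≠ 0 := by
    rintro rfl
    simp [hw0] at hfix'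
  have hyn : ‖y‖ ≤ ε := by simpa using hy
  have heq : y⁻¹ + ψ y = w := by
    rw [inv_mul_eq_iff_eq_mul₀ hw0] at hfix'
    field_simp
    rw [mul_comm y w] at *
    linear_combination hfix'
  have hs0 : s ≠ 0 := by
    rintro rfl; have := hs.1; simp at this; linarith
  have := hinj (x₁ := y) (x₂ := s) ⟨by simp; linarith, hy0⟩ ⟨by simpa using hs.2.trans h1, hs0⟩ heq
  rw [this] at hyn
  linarith [hs.1]

/-- A crude form of the area theorem. -/
lemma area_thm (φ : ℂ → ℂ) (hd : DifferentiableOn ℂ φ (Metric.ball 0 1))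
    (hinj : InjOn (fun s => s⁻¹ + φ s) (Metric.ball 0 1 \ {0})) : ‖deriv φ 0‖ ≤ 5 / 2 := by
  set ψ : ℂ → ℂ := fun s => φ s - φ 0 with hψ
  set b := deriv φ 0 with hb
  have hnhds : Metric.ball (0:ℂ) 1 ∈ 𝓝 0 := Metric.ball_mem_nhds _ one_pos
  have hψd : DifferentiableOn ℂ ψ (Metric.ball 0 1) := hd.sub_const _
  have hψb : deriv ψ 0 = b := by simp [hψ, hb]
  have hinjψ : InjOn (fun s => s⁻¹ + ψ s) (Metric.ball 0 1 \ {0}) := by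
    intro x hx y hy hxy
    apply hinj hx hy
    simp only [hψ] at hxy ⊢
    linear_combination hxy
  set ψ1 := dslope ψ 0 with hψ1
  set ψ2 := dslope ψ1 0 with hψ2
  have hd1 : DifferentiableOn ℂ ψ1 (Metric.ball 0 1) := (Complex.differentiableOn_dslope hnhds).2 hψd
  have hd2 : DifferentiableOn ℂ ψ2 (Metric.ball 0 1) := (Complex.differentiableOn_dslope hnhds).2 hd1
  have e1 : ∀ s, ψ s = b * s + s ^ 2 * ψ2 s := by
    intro s
    have a1 := sub_smul_dslope ψ 0 s
    have a2 := sub_smul_dslope ψ1 0 s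
    have a3 : ψ1 0 = b := by rw [hψ1, dslope_same, hψb]
    have a4 : ψ 0 = 0 := by simp [hψ]
    rw [a3] at a2
    rw [a4] at a1
    simp only [smul_eq_mul, sub_zero] at a1 a2
    rw [← a1, pow_two, mul_assoc, a2]; ring
  have hcomp : IsCompact (Metric.closedBall (0:ℂ) (1/2)) := isCompact_closedBall _ _
  have hsub : Metric.closedBall (0:ℂ) (1/2) ⊆ Metric.ball 0 1 := Metric.closedBall_subset_ball (by norm_num)
  obtain ⟨C, hC⟩ := hcomp.exists_bound_of_continuousOn (hd2.continuousOn.mono hsub)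
  have hd3 : DifferentiableOn ℂ (fun s => s * ψ s) (Metric.ball 0 1) := differentiableOn_id.mul hψd
  obtain ⟨K', hK'⟩ := hcomp.exists_bound_of_continuousOn
    ((hd3.deriv Metric.isOpen_ball).continuousOn.mono hsub)
  set K : NNReal := K'.toNNReal
  have hK : LipschitzOnWith K (fun s => s * ψ s) (Metric.closedBall (0:ℂ) (1/2)) := by
    apply Convex.lipschitzOnWith_of_nnnorm_deriv_le (𝕜 := ℂ) (s := Metric.closedBall (0:ℂ) (1/2))
    · intro x hx
      exact hd3.differentiableAt (Metric.isOpen_ball.mem_nhds (hsub hx))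
    · intro x hx
      rw [← NNReal.coe_le_coe, coe_nnnorm]
      exact (hK' x hx).trans (Real.le_coe_toNNReal _)
    · exact convex_closedBall _ _
  have hC0 : 0 ≤ C := (norm_nonneg _).trans (hC 0 (by simp))
  have main : ∀ r ε : ℝ, 0 < ε → ε ≤ 1/2 → ε * K < 1 → ε < r → r < 1 →
      - r⁻¹ ^ 2 + ‖b‖ ^ 2 * (r ^ 2 - ε ^ 2) ≤ 2 * ‖b‖ + 2 * C * ε + (‖b‖ * ε + C * ε ^ 2) ^ 2 := by
    intro r ε h0 h1 h2 h3 h4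
    have l := aux_area_lower ψ hψd hinjψ ε r h0 h3 h4
    have u := measure_mono (μ := volume) (aux_upper ψ ψ2 b C K (fun s _ => e1 s) hC hK hinjψ ε r h0 h1 h2 h4)
    have lu := l.trans u
    set M := ε⁻¹ + ‖b‖ * ε + C * ε ^ 2 with hM
    have hM0 : 0 ≤ M := by positivity
    rw [Complex.volume_closedBall, hψb, ← ENNReal.ofReal_pow hM0,
      show ((NNReal.pi : NNReal) : ENNReal) = ENNReal.ofReal Real.pi by
        rw [← NNReal.coe_real_pi, ENNReal.ofReal_coe_nnreal],
      ← ENNReal.ofReal_mul (by positivity), ENNReal.ofReal_le_ofReal_iff (by positivity), mul_comm (M ^ 2),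
      mul_le_mul_iff_right₀ Real.pi_pos] at lu
    have : M ^ 2 = ε⁻¹ ^ 2 + 2 * ‖b‖ + 2 * C * ε + (‖b‖ * ε + C * ε ^ 2) ^ 2 := by
      rw [hM]; field_simp; ring
    linarith
  have step1 : ∀ r : ℝ, 0 < r → r < 1 → - r⁻¹ ^ 2 + ‖b‖ ^ 2 * r ^ 2 ≤ 2 * ‖b‖ := by
    intro r hr0 hr1
    have t1 : Tendsto (fun ε : ℝ => - r⁻¹ ^ 2 + ‖b‖ ^ 2 * (r ^ 2 - ε ^ 2)) (𝓝[>] 0)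
      (𝓝 (- r⁻¹ ^ 2 + ‖b‖ ^ 2 * (r ^ 2 - 0 ^ 2))) :=
      (Continuous.tendsto (by fun_prop) 0).mono_left nhdsWithin_le_nhds
    have t2 : Tendsto (fun ε : ℝ => 2 * ‖b‖ + 2 * C * ε + (‖b‖ * ε + C * ε ^ 2) ^ 2) (𝓝[>] 0)
      (𝓝 (2 * ‖b‖ + 2 * C * 0 + (‖b‖ * 0 + C * 0 ^ 2) ^ 2)) :=
      (Continuous.tendsto (by fun_prop) 0).mono_left nhdsWithin_le_nhds
    have t3 : ∀ᶠ ε : ℝ in 𝓝[>] 0, ε * K < 1 :=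
      ((Continuous.tendsto (f := fun ε : ℝ => ε * K) (by fun_prop) 0).mono_left nhdsWithin_le_nhds).eventually_lt_const
        (by simp)
    have := le_of_tendsto_of_tendsto t1 t2 (by
      filter_upwards [self_mem_nhdsWithin, t3, Ioo_mem_nhdsGT (show (0:ℝ) < 1/2 by norm_num),
        Ioo_mem_nhdsGT hr0] with ε a1 a2 a3 a4
      exact main r ε a1 a3.2.le a2 a4.2 hr1)
    simpa using this
  have t1 : Tendsto (fun r : ℝ => - r⁻¹ ^ 2 + ‖b‖ ^ 2 * r ^ 2) (𝓝[<] 1)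
      (𝓝 (- 1⁻¹ ^ 2 + ‖b‖ ^ 2 * 1 ^ 2)) := by
    apply Tendsto.mono_left _ nhdsWithin_le_nhds
    have : Tendsto (fun r : ℝ => r⁻¹) (𝓝 1) (𝓝 1⁻¹) := tendsto_inv₀ one_ne_zero
    exact (this.pow 2).neg.add ((tendsto_id.pow 2).const_mul _)
  have := le_of_tendsto t1 (by
    filter_upwards [Ioo_mem_nhdsLT (show (0:ℝ) < 1 by norm_num)] with r hr
    exact step1 r hr.1 hr.2)
  norm_num at this
  nlinarith [norm_nonneg b]

lemma d1_mul {u v : ℂ → ℂ} {x : ℂ} (hu : AnalyticAt ℂ u x) (hv : AnalyticAt ℂ v x) :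
    deriv (fun s => u s * v s) =ᶠ[𝓝 x] fun s => deriv u s * v s + u s * deriv v s := by
  filter_upwards [hu.eventually_analyticAt, hv.eventually_analyticAt] with y h1 h2
  exact deriv_fun_mul h1.differentiableAt h2.differentiableAt

lemma d2_mul {u v : ℂ → ℂ} {x : ℂ} (hu : AnalyticAt ℂ u x) (hv : AnalyticAt ℂ v x) :
    deriv (deriv (fun s => u s * v s)) =ᶠ[𝓝 x] fun s => deriv (deriv u) s * v s +
      2 * (deriv u s * deriv v s) + u s * deriv (deriv v) s := by
  filter_upwards [hu.eventually_analyticAt, hv.eventually_analyticAt] with y h1 h2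
  rw [(d1_mul h1 h2).deriv_eq, deriv_fun_add (h1.deriv.differentiableAt.fun_mul h2.differentiableAt)
    (h1.differentiableAt.fun_mul h2.deriv.differentiableAt), deriv_fun_mul h1.deriv.differentiableAt h2.differentiableAt,
    deriv_fun_mul h1.differentiableAt h2.deriv.differentiableAt]
  ring

lemma d3_mul {u v : ℂ → ℂ} {x : ℂ} (hu : AnalyticAt ℂ u x) (hv : AnalyticAt ℂ v x) :
    deriv (deriv (deriv (fun s => u s * v s))) x = deriv (deriv (deriv u)) x * v x +
      3 * (deriv (deriv u) x * deriv v x) + 3 * (deriv u x * deriv (deriv v) x)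
      + u x * deriv (deriv (deriv v)) x := by
  rw [(d2_mul hu hv).deriv_eq]
  have a1 := hu.differentiableAt
  have a2 := hu.deriv.differentiableAt
  have a3 := hu.deriv.deriv.differentiableAt
  have b1 := hv.differentiableAt
  have b2 := hv.deriv.differentiableAt
  have b3 := hv.deriv.deriv.differentiableAt
  rw [deriv_fun_add (by fun_prop) (by fun_prop), deriv_fun_add (by fun_prop) (by fun_prop),
    deriv_fun_mul a3 b1, deriv_const_mul _ (by fun_prop), deriv_fun_mul a2 b2, deriv_fun_mul a1 b3]
  ring

/-- Data attached to a normalised univalent function. -/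
lemma univ_data (g : ℂ → ℂ) (hd : DifferentiableOn ℂ g (Metric.ball 0 1))
    (hinj : InjOn g (Metric.ball 0 1)) (h0 : g 0 = 0) (h1 : deriv g 0 = 1) :
    ∃ κ : ℂ → ℂ, DifferentiableOn ℂ κ (Metric.ball 0 1) ∧ κ 0 = 1 ∧
      (∀ s ∈ Metric.ball (0:ℂ) 1, κ s ≠ 0) ∧ (∀ s ∈ Metric.ball (0:ℂ) 1, g s * κ s = s) ∧
      deriv κ 0 = - deriv (deriv g) 0 / 2 ∧ deriv (deriv κ) 0 = - schwarzian g 0 / 3 := by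
  have hnhds : Metric.ball (0:ℂ) 1 ∈ 𝓝 0 := Metric.ball_mem_nhds _ one_pos
  set k := dslope g 0 with hk
  have hkd : DifferentiableOn ℂ k (Metric.ball 0 1) := (Complex.differentiableOn_dslope hnhds).2 hd
  have hk0 : k 0 = 1 := by rw [hk, dslope_same, h1]
  have hgk : ∀ s, g s = s * k s := by
    intro s
    have := sub_smul_dslope g 0 s
    simp only [h0, sub_zero, smul_eq_mul] at this
    exact this.symm
  have hkne : ∀ s ∈ Metric.ball (0:ℂ) 1, k s ≠ 0 := by
    intro s hs hks
    by_cases hs0 : s = 0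
    · rw [hs0, hk0] at hks; exact one_ne_zero hks
    · apply hs0
      apply hinj hs (by simp)
      rw [h0, hgk, hks, mul_zero]
  have hκd : DifferentiableOn ℂ (fun s => (k s)⁻¹) (Metric.ball 0 1) := hkd.inv hkne
  have hmul : ∀ s ∈ Metric.ball (0:ℂ) 1, g s * (k s)⁻¹ = s := by
    intro s hs
    rw [hgk, mul_assoc, mul_inv_cancel₀ (hkne s hs), mul_one]
  refine ⟨fun s => (k s)⁻¹, hκd, by simp [hk0], fun s hs => inv_ne_zero (hkne s hs), hmul, ?_⟩
  set κ := fun s => (k s)⁻¹ with hκ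
  have ag : AnalyticAt ℂ g 0 := hd.analyticAt hnhds
  have aκ : AnalyticAt ℂ κ 0 := hκd.analyticAt hnhds
  have hκ0 : κ 0 = 1 := by simp [hκ, hk0]
  have he : (fun s => g s * κ s) =ᶠ[𝓝 0] fun s => s := by
    filter_upwards [hnhds] with s hs using hmul s hs
  have e2 : deriv (deriv (fun s => g s * κ s)) 0 = 0 := by
    rw [he.deriv.deriv_eq]; simp
  have e3 : deriv (deriv (deriv (fun s => g s * κ s))) 0 = 0 := by
    rw [he.deriv.deriv.deriv_eq]; simp
  rw [(d2_mul ag aκ).eq_of_nhds, h0, h1, hκ0] at e2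
  rw [d3_mul ag aκ, h0, h1, hκ0] at e3
  have f1 : deriv κ 0 = - deriv (deriv g) 0 / 2 := by linear_combination e2 / 2
  refine ⟨f1, ?_⟩
  rw [f1] at e3
  simp only [schwarzian, h1]
  linear_combination e3 / 3

lemma schwarzian_bound (g : ℂ → ℂ) (hd : DifferentiableOn ℂ g (Metric.ball 0 1))
    (hinj : InjOn g (Metric.ball 0 1)) (h0 : g 0 = 0) (h1 : deriv g 0 = 1) :
    ‖schwarzian g 0‖ ≤ 15 := by
  obtain ⟨κ, hκd, hκ0, hκne, hmul, -, hS⟩ := univ_data g hd hinj h0 h1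
  have hnhds : Metric.ball (0:ℂ) 1 ∈ 𝓝 0 := Metric.ball_mem_nhds _ one_pos
  set φ := dslope κ 0 with hφ
  have hφd : DifferentiableOn ℂ φ (Metric.ball 0 1) := (Complex.differentiableOn_dslope hnhds).2 hκd
  have hκφ : ∀ s, κ s = 1 + s * φ s := by
    intro s
    have := sub_smul_dslope κ 0 s
    simp only [hκ0, sub_zero, smul_eq_mul] at this
    rw [this]; ring
  have hder : deriv φ 0 = - schwarzian g 0 / 6 := by
    have e : deriv (deriv κ) 0 = 2 * deriv φ 0 := by
      have : κ = fun s => 1 + s * φ s := funext hκφ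
      rw [this]
      have : deriv (fun s => 1 + s * φ s) = deriv (fun s => s * φ s) := by
        ext s; rw [deriv_const_add]
      rw [this, (d2_mul (u := fun s => s) analyticAt_id (hφd.analyticAt hnhds)).eq_of_nhds]
      simp
    rw [hS] at e
    linear_combination -e / 2
  have := area_thm φ hφd (by
    have key : ∀ s ∈ Metric.ball (0:ℂ) 1 \ {0}, s⁻¹ + φ s = (g s)⁻¹ := by
      intro s hs
      have hs0 : s ≠ 0 := hs.2
      have m := hmul s hs.1
      have hg0 : g s ≠ 0 := by
        intro h; rw [h, zero_mul] at m; exact hs0 m.symm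
      rw [hκφ] at m
      field_simp
      linear_combination m
    intro s hs t ht hst
    simp only [key s hs, key t ht] at hst
    exact hinj hs.1 ht.1 (inv_injective hst))
  rw [hder, norm_div, norm_neg] at this
  norm_num at this
  linarith

lemma exists_sqrt (κ : ℂ → ℂ) (hκd : DifferentiableOn ℂ κ (Metric.ball 0 1)) (hκ0 : κ 0 = 1)
    (hκne : ∀ s ∈ Metric.ball (0:ℂ) 1, κ s ≠ 0) :
    ∃ σ : ℂ → ℂ, DifferentiableOn ℂ σ (Metric.ball 0 1) ∧ σ 0 = 1 ∧
      ∀ s ∈ Metric.ball (0:ℂ) 1, σ s ^ 2 = κ s := by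
  obtain ⟨L, hL⟩ := ((hκd.deriv Metric.isOpen_ball).div hκd hκne).isExactOn_ball
  have hL : ∀ s ∈ Metric.ball (0:ℂ) 1, HasDerivAt L (deriv κ s / κ s) s := hL
  have hLd : DifferentiableOn ℂ L (Metric.ball 0 1) :=
    fun s hs => (hL s hs).differentiableAt.differentiableWithinAt
  refine ⟨fun s => Complex.exp ((L s - L 0) / 2), ?_, by simp, ?_⟩
  · fun_prop
  · set q : ℂ → ℂ := fun s => κ s * Complex.exp (-(L s - L 0)) with hq
    have hqd : ∀ s ∈ Metric.ball (0:ℂ) 1, HasDerivAt q 0 s := by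
      intro s hs
      have h1 := (hκd.differentiableAt (Metric.isOpen_ball.mem_nhds hs)).hasDerivAt
      have h2 := (((hL s hs).sub_const (L 0)).neg).cexp
      refine (h1.mul h2).congr_deriv ?_
      have := hκne s hs
      field_simp
      simp
    intro s hs
    have hc : q s = q 0 := by
      apply (convex_ball (0:ℂ) 1).is_const_of_fderivWithin_eq_zero (𝕜 := ℂ)
        (fun x hx => (hqd x hx).differentiableAt.differentiableWithinAt) _ hs (by simp)
      intro x hx
      rw [fderivWithin_of_isOpen Metric.isOpen_ball hx]
      have := (hqd x hx).hasFDerivAt.fderiv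
      rw [this]; ext; simp
    simp only [hq, hκ0] at hc
    rw [Complex.exp_neg] at hc
    have := Complex.exp_ne_zero (L s - L 0)
    rw [← Complex.exp_nat_mul]
    push_cast
    rw [mul_div_cancel₀ _ (two_ne_zero)]
    field_simp at hc
    simp at hc
    exact hc.symm

lemma second_coeff_bound (g : ℂ → ℂ) (hd : DifferentiableOn ℂ g (Metric.ball 0 1))
    (hinj : InjOn g (Metric.ball 0 1)) (h0 : g 0 = 0) (h1 : deriv g 0 = 1) :
    ‖deriv (deriv g) 0‖ ≤ 10 := by
  obtain ⟨κ, hκd, hκ0, hκne, hmul, hS, -⟩ := univ_data g hd hinj h0 h1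
  obtain ⟨σ, hσd, hσ0, hσ⟩ := exists_sqrt κ hκd hκ0 hκne
  have hnhds : Metric.ball (0:ℂ) 1 ∈ 𝓝 0 := Metric.ball_mem_nhds _ one_pos
  set τ := dslope σ 0 with hτ
  have hτd : DifferentiableOn ℂ τ (Metric.ball 0 1) := (Complex.differentiableOn_dslope hnhds).2 hσd
  have hστ : ∀ s, σ s = 1 + s * τ s := by
    intro s
    have := sub_smul_dslope σ 0 s
    simp only [hσ0, sub_zero, smul_eq_mul] at this
    rw [this]; ring
  have hsq : ∀ s ∈ Metric.ball (0:ℂ) 1, s ^ 2 ∈ Metric.ball (0:ℂ) 1 := by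
    intro s hs
    rw [mem_ball_zero_iff] at hs ⊢
    rw [norm_pow]
    exact pow_lt_one₀ (norm_nonneg _) hs two_ne_zero
  have hτ2 : DifferentiableOn ℂ (fun s => τ (s ^ 2)) (Metric.ball 0 1) :=
    hτd.comp (f := fun s : ℂ => s ^ 2) (by fun_prop) hsq
  set φ : ℂ → ℂ := fun s => s * τ (s ^ 2) with hφ
  have hφd : DifferentiableOn ℂ φ (Metric.ball 0 1) := differentiableOn_id.mul hτ2
  have hder : deriv φ 0 = - deriv (deriv g) 0 / 4 := by
    have e1 : deriv φ 0 = τ 0 := by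
      rw [hφ, (d1_mul (u := fun s => s) analyticAt_id (hτ2.analyticAt hnhds)).eq_of_nhds]
      simp
    have e2 : τ 0 = deriv σ 0 := by rw [hτ, dslope_same]
    have e3 : deriv κ 0 = 2 * deriv σ 0 := by
      have : κ =ᶠ[𝓝 0] fun s => σ s * σ s := by
        filter_upwards [hnhds] with s hs
        rw [← hσ s hs, pow_two]
      rw [this.deriv_eq, (d1_mul (hσd.analyticAt hnhds) (hσd.analyticAt hnhds)).eq_of_nhds, hσ0]
      ring
    rw [e1, e2]
    rw [hS] at e3
    linear_combination -e3 / 2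
  have key : ∀ s ∈ Metric.ball (0:ℂ) 1 \ {0}, s⁻¹ + φ s = σ (s ^ 2) / s := by
    intro s hs
    have hs0 : s ≠ 0 := hs.2
    rw [hστ, hφ]
    field_simp
  have key2 : ∀ s ∈ Metric.ball (0:ℂ) 1 \ {0}, (s⁻¹ + φ s) ^ 2 = (g (s ^ 2))⁻¹ := by
    intro s hs
    have hs0 : s ≠ 0 := hs.2
    have m := hmul _ (hsq s hs.1)
    have hg0 : g (s ^ 2) ≠ 0 := by
      intro h; rw [h, zero_mul] at m; exact pow_ne_zero 2 hs0 m.symm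
    rw [key s hs, div_pow, hσ _ (hsq s hs.1)]
    field_simp
    linear_combination m
  have := area_thm φ hφd (by
    intro s hs t ht hst
    have hst : s⁻¹ + φ s = t⁻¹ + φ t := hst
    have h2 : (s⁻¹ + φ s) ^ 2 = (t⁻¹ + φ t) ^ 2 := by rw [hst]
    rw [key2 s hs, key2 t ht] at h2
    have h3 := hinj (hsq s hs.1) (hsq t ht.1) (inv_injective h2)
    rcases sq_eq_sq_iff_eq_or_eq_neg.1 h3 with h | h
    · exact h
    · exfalso
      rw [key s hs, key t ht, h3, h] at hst
      have ht0 : t ≠ 0 := ht.2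
      have hne : σ (t ^ 2) ≠ 0 := by
        intro h'
        have := hσ _ (hsq t ht.1)
        rw [h'] at this
        exact hκne _ (hsq t ht.1) (by rw [← this]; ring)
      rw [div_neg] at hst
      have : σ (t ^ 2) / t = 0 := by linear_combination -hst / 2
      rcases div_eq_zero_iff.1 this with h | h
      exacts [hne h, ht0 h])
  rw [hder, norm_div, norm_neg] at this
  norm_num at this
  linarith

lemma koebe_bound (g : ℂ → ℂ) (hd : DifferentiableOn ℂ g (Metric.ball 0 1))
    (hinj : InjOn g (Metric.ball 0 1)) (h0 : g 0 = 0) (h1 : deriv g 0 = 1) (c : ℂ)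
    (hc : ∀ s ∈ Metric.ball (0:ℂ) 1, g s ≠ c) : 1 ≤ 10 * ‖c‖ := by
  have hnhds : Metric.ball (0:ℂ) 1 ∈ 𝓝 0 := Metric.ball_mem_nhds _ one_pos
  have hc0 : c ≠ 0 := fun h => hc 0 (by simp) (by rw [h0, h])
  have hne : ∀ s ∈ Metric.ball (0:ℂ) 1, c - g s ≠ 0 := fun s hs h => hc s hs (sub_eq_zero.1 h).symm
  set q : ℂ → ℂ := fun s => c * g s / (c - g s) with hq
  have hqd : DifferentiableOn ℂ q (Metric.ball 0 1) := (hd.const_mul c).div (hd.const_sub c) hne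
  have hqinj : InjOn q (Metric.ball 0 1) := by
    intro s hs t ht hst
    apply hinj hs ht
    simp only [hq] at hst
    have a1 := hne s hs
    have a2 := hne t ht
    rw [div_eq_div_iff a1 a2] at hst
    have : c ^ 2 * (g s - g t) = 0 := by linear_combination hst
    rcases mul_eq_zero.1 this with h | h
    · exact absurd h (pow_ne_zero 2 hc0)
    · exact sub_eq_zero.1 h
  have hq0 : q 0 = 0 := by simp [hq, h0]
  have ag : AnalyticAt ℂ g 0 := hd.analyticAt hnhds
  have aq : AnalyticAt ℂ q 0 := hqd.analyticAt hnhds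
  have acg : AnalyticAt ℂ (fun s => c - g s) 0 := analyticAt_const.sub ag
  have he : (fun s => q s * (c - g s)) =ᶠ[𝓝 0] fun s => c * g s := by
    filter_upwards [hnhds] with s hs
    have := hne s hs
    simp only [hq]; field_simp
  have dcg : deriv (fun s => c - g s) = fun s => - deriv g s := by
    ext s; rw [deriv_const_sub]
  have dc : deriv (fun s => c * g s) = fun s => c * deriv g s := by
    ext s; rw [deriv_const_mul_field]
  have e1 := he.deriv_eq
  rw [(d1_mul aq acg).eq_of_nhds, dcg, dc, hq0, h0] at e1
  simp only [h1] at e1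
  have e2 := he.deriv.deriv_eq
  rw [(d2_mul aq acg).eq_of_nhds, dcg, dc, hq0, h0, deriv_const_mul_field] at e2
  simp only [h1] at e2
  have hq1 : deriv q 0 = 1 := by
    have : c * (deriv q 0 - 1) = 0 := by linear_combination e1
    rcases mul_eq_zero.1 this with h | h
    · exact absurd h hc0
    · exact sub_eq_zero.1 h
  rw [hq1] at e2
  have e3 : deriv (deriv q) 0 - deriv (deriv g) 0 = 2 / c := by
    field_simp
    linear_combination e2
  have b1 := second_coeff_bound g hd hinj h0 h1
  have b2 := second_coeff_bound q hqd hqinj hq0 hq1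
  have b3 : ‖(2:ℂ) / c‖ ≤ 20 := by
    rw [← e3]; exact (norm_sub_le _ _).trans (by linarith)
  rw [norm_div] at b3
  have : 0 < ‖c‖ := norm_pos_iff.2 hc0
  rw [div_le_iff₀ this] at b3
  norm_num at b3
  linarith

lemma c1_comp {h G : ℂ → ℂ} {x : ℂ} (hh : AnalyticAt ℂ h (G x)) (hG : AnalyticAt ℂ G x) :
    deriv (fun s => h (G s)) =ᶠ[𝓝 x] fun s => deriv h (G s) * deriv G s := by
  filter_upwards [hG.eventually_analyticAt, hG.continuousAt.eventually hh.eventually_analyticAt] with y h1 h2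
  exact deriv_comp y h2.differentiableAt h1.differentiableAt

lemma schwarzian_chain {f G : ℂ → ℂ} {x : ℂ} (hf : AnalyticAt ℂ f (G x)) (hG : AnalyticAt ℂ G x)
    (he : (fun s => f (G s)) =ᶠ[𝓝 x] Complex.exp) :
    deriv f (G x) ≠ 0 ∧ deriv G x ≠ 0 ∧
    schwarzian f (G x) * deriv G x ^ 2 + schwarzian G x = - 1 / 2 := by
  have E1 := (c1_comp hf hG).symm.trans he.deriv
  rw [Complex.deriv_exp] at E1
  have E2 := E1.deriv
  rw [Complex.deriv_exp] at E2
  have E3 := E2.deriv_eq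
  rw [Complex.deriv_exp] at E3
  have aF : AnalyticAt ℂ (fun s => deriv f (G s)) x := hf.deriv.comp hG
  rw [(d2_mul aF hG.deriv).eq_of_nhds] at E3
  have E2 := E2.eq_of_nhds
  rw [(d1_mul aF hG.deriv).eq_of_nhds] at E2
  have E1 := E1.eq_of_nhds
  have u1 := c1_comp hf.deriv hG
  have u2 := u1.deriv_eq
  have aF2 : AnalyticAt ℂ (fun s => deriv (deriv f) (G s)) x := hf.deriv.deriv.comp hG
  rw [(d1_mul aF2 hG.deriv).eq_of_nhds] at u2
  simp only [(c1_comp hf.deriv.deriv hG).eq_of_nhds] at u2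
  have u1 := u1.eq_of_nhds
  simp only [u1, u2] at E1 E2 E3
  set E := Complex.exp x with hE
  have hE0 : E ≠ 0 := Complex.exp_ne_zero x
  have hf1 : deriv f (G x) ≠ 0 := by
    intro h; rw [h, zero_mul] at E1; exact hE0 E1.symm
  have hg1 : deriv G x ≠ 0 := by
    intro h; rw [h, mul_zero] at E1; exact hE0 E1.symm
  refine ⟨hf1, hg1, ?_⟩
  simp only [schwarzian]
  generalize deriv (deriv (deriv f)) (G x) = f3 at *
  generalize deriv (deriv f) (G x) = f2 at *
  generalize deriv f (G x) = f1 at *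
  generalize deriv (deriv (deriv G)) x = g3 at *
  generalize deriv (deriv G) x = g2 at *
  generalize deriv G x = g1 at *
  have e2 : g2 = (f1 * g1 - f2 * g1 ^ 2) / f1 := by
    field_simp; linear_combination E2 - E1
  have e3 : g3 = (f1 * g1 - f3 * g1 ^ 3 - 3 * f2 * g1 * g2) / f1 := by
    field_simp; linear_combination E3 - E1
  rw [e3, e2]
  field_simp
  ring

lemma concl_bound {f G : ℂ → ℂ} {z z0 ζ : ℂ} {x : ℝ} (hx : 0 < x)
    (hd : DifferentiableOn ℂ G (Metric.ball ζ x)) (hinj : InjOn G (Metric.ball ζ x))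
    (hom : ∀ s ∈ Metric.ball ζ x, G s ≠ z0) (hz : G ζ = z) (hf : AnalyticAt ℂ f z)
    (he : (fun s => f (G s)) =ᶠ[𝓝 ζ] Complex.exp) :
    x ^ 2 ≤ 32 * Real.pi ^ 2 * norm ((z - z0) ^ 2 * schwarzian f z) + 16 * Real.pi ^ 2 + 12 := by
  subst hz
  have aG : AnalyticAt ℂ G ζ := hd.analyticAt (Metric.ball_mem_nhds _ hx)
  obtain ⟨hf1, hg1, hch⟩ := schwarzian_chain hf aG he
  have hxc : (x : ℂ) ≠ 0 := by exact_mod_cast hx.ne'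
  set c : ℂ := (x : ℂ) * deriv G ζ with hc
  have hc0 : c ≠ 0 := mul_ne_zero hxc hg1
  set g : ℂ → ℂ := fun s => c⁻¹ * (G (ζ + x * s) - G ζ) with hg
  have hmem : ∀ s ∈ Metric.ball (0:ℂ) 1, ζ + x * s ∈ Metric.ball ζ x := by
    intro s hs
    rw [mem_ball_zero_iff] at hs
    rw [mem_ball_iff_norm, add_sub_cancel_left, norm_mul, Complex.norm_real, Real.norm_of_nonneg hx.le]
    nlinarith
  have hgd : DifferentiableOn ℂ g (Metric.ball 0 1) := by
    apply DifferentiableOn.const_mul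
    apply DifferentiableOn.sub_const
    exact hd.comp (f := fun s : ℂ => ζ + x * s) (by fun_prop) hmem
  have hginj : InjOn g (Metric.ball 0 1) := by
    intro s hs t ht hst
    have h1 := mul_left_cancel₀ (inv_ne_zero hc0) hst
    have h2 := hinj (hmem s hs) (hmem t ht) (sub_left_inj.1 h1)
    exact mul_left_cancel₀ hxc (add_left_cancel h2)
  have dd : ∀ (F : ℂ → ℂ), deriv (fun s => F (ζ + x * s)) = fun s => x * deriv F (ζ + x * s) := by
    intro F
    ext s
    have := deriv_comp_mul_left (x:ℂ) (fun s => F (ζ + s)) s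
    rw [this, deriv_comp_const_add]; rfl
  have D1 : deriv g = fun s => c⁻¹ * x * deriv G (ζ + x * s) := by
    ext s
    simp only [hg, deriv_const_mul_field, deriv_sub_const, dd]
    ring
  have D2 : deriv (deriv g) = fun s => c⁻¹ * x ^ 2 * deriv (deriv G) (ζ + x * s) := by
    ext s
    simp only [D1, deriv_const_mul_field, dd]
    ring
  have D3 : deriv (deriv (deriv g)) = fun s => c⁻¹ * x ^ 3 * deriv (deriv (deriv G)) (ζ + x * s) := by
    ext s
    simp only [D2, deriv_const_mul_field, dd]
    ring
  have g0 : g 0 = 0 := by simp [hg]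
  have g1 : deriv g 0 = 1 := by
    rw [D1]; simp only [mul_zero, add_zero]
    rw [mul_assoc]; exact inv_mul_cancel₀ hc0
  have hS : schwarzian g 0 = x ^ 2 * schwarzian G ζ := by
    rw [schwarzian, D3, D2, g1, schwarzian]
    simp only [mul_zero, add_zero, hc]
    field_simp
  have b1 := schwarzian_bound g hgd hginj g0 g1
  have b2 := koebe_bound g hgd hginj g0 g1 (c⁻¹ * (z0 - G ζ)) (by
    intro s hs h
    have h1 := mul_left_cancel₀ (inv_ne_zero hc0) h
    exact hom _ (hmem s hs) (sub_left_inj.1 h1))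
  rw [norm_mul, norm_inv] at b2
  have hcp : 0 < ‖c‖ := norm_pos_iff.2 hc0
  have b3 : ‖c‖ ≤ 10 * ‖G ζ - z0‖ := by
    rw [norm_sub_rev]
    have := mul_le_mul_of_nonneg_left b2 hcp.le
    field_simp at this
    linarith
  have b4 : schwarzian f (G ζ) * c ^ 2 = - (x : ℂ) ^ 2 / 2 - schwarzian g 0 := by
    rw [hS, hc]; linear_combination (x : ℂ) ^ 2 * hch
  have b5 : x ^ 2 / 2 ≤ ‖schwarzian f (G ζ)‖ * ‖c‖ ^ 2 + 15 := by
    have : ((x : ℂ) ^ 2 / 2) = - (schwarzian f (G ζ) * c ^ 2) - schwarzian g 0 := by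
      rw [b4]; ring
    have h2 : ‖((x : ℂ) ^ 2 / 2)‖ = x ^ 2 / 2 := by
      simp
    rw [← h2, this]
    refine (norm_sub_le _ _).trans ?_
    rw [norm_neg, norm_mul, norm_pow]
    linarith
  have hpi := Real.pi_gt_three
  rw [norm_mul, norm_pow]
  have b6 : ‖c‖ ^ 2 ≤ 100 * ‖G ζ - z0‖ ^ 2 := by nlinarith
  have hpi2 : 9 < Real.pi ^ 2 := by nlinarith
  have b7 : ‖schwarzian f (G ζ)‖ * ‖c‖ ^ 2 ≤ ‖schwarzian f (G ζ)‖ * (16 * Real.pi ^ 2 * ‖G ζ - z0‖ ^ 2) := by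
    apply mul_le_mul_of_nonneg_left _ (norm_nonneg _)
    refine b6.trans ?_
    apply mul_le_mul_of_nonneg_right _ (by positivity)
    linarith
  nlinarith

lemma final_ineqs {R : ℝ} (hR : 1 ≤ R) {w : ℂ} (hw : R < ‖w‖) (d S : ℂ)
    (h : (Real.log (norm w / R)) ^ 2
          ≤ 32 * Real.pi ^ 2 * norm (d ^ 2 * S) + 16 * Real.pi ^ 2 + 12) :
    (1 / (2 * R)) * Real.exp (-Real.sqrt
            (32 * Real.pi ^ 2 * norm (d ^ 2 * S)
              + 16 * Real.pi ^ 2 + 12))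
        ≤ chordal (some w) none ∧
      (1 / R) * Real.exp
            (-(20 * norm d * Real.sqrt (norm S)) - 20)
        ≤ (1 / (2 * R)) * Real.exp (-Real.sqrt
            (32 * Real.pi ^ 2 * norm (d ^ 2 * S)
              + 16 * Real.pi ^ 2 + 12)) := by
  have hR0 : 0 < R := by linarith
  have hw0 : 0 < ‖w‖ := by linarith
  constructor
  · set T := 32 * Real.pi ^ 2 * norm (d ^ 2 * S) + 16 * Real.pi ^ 2 + 12
    have h1 : Real.log (‖w‖ / R) ≤ Real.sqrt T := Real.le_sqrt_of_sq_le h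
    have h2 : ‖w‖ ≤ R * Real.exp (Real.sqrt T) := by
      rw [Real.log_le_iff_le_exp (by positivity), div_le_iff₀ hR0] at h1
      linarith
    simp only [chordal]
    have h3 : (1 / (2 * R)) * Real.exp (-Real.sqrt T) = 1 / (2 * R * Real.exp (Real.sqrt T)) := by
      rw [Real.exp_neg]; field_simp
    rw [h3]
    apply one_div_le_one_div_of_le (by positivity)
    apply Real.sqrt_le_iff.2
    refine ⟨by positivity, ?_⟩
    nlinarith
  · have hn : ‖d ^ 2 * S‖ = (‖d‖ * Real.sqrt ‖S‖) ^ 2 := by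
      rw [norm_mul, norm_pow, mul_pow, Real.sq_sqrt (norm_nonneg _)]
    rw [hn, mul_assoc 20]
    have ha : 0 ≤ ‖d‖ * Real.sqrt ‖S‖ := by positivity
    set a := ‖d‖ * Real.sqrt ‖S‖
    have hpi : Real.pi < 3.15 := Real.pi_lt_d2
    have hpi2 : Real.pi ^ 2 < 10 := by nlinarith [Real.pi_pos]
    have h1 : Real.sqrt (32 * Real.pi ^ 2 * a ^ 2 + 16 * Real.pi ^ 2 + 12) ≤ 18 * a + 18 := by
      apply Real.sqrt_le_iff.2
      refine ⟨by positivity, ?_⟩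
      nlinarith [mul_le_mul_of_nonneg_right hpi2.le (sq_nonneg a)]
    have h2 : Real.log 2 ≤ 1 := by linarith [Real.log_two_lt_d9]
    have h3 : (1 / R) * Real.exp (-(20 * a) - 20) ≤ (1/ R) * (Real.exp (- (18 * a + 18)) * Real.exp (- Real.log 2)) := by
      rw [← Real.exp_add]
      gcongr
      linarith
    refine h3.trans ?_
    rw [Real.exp_neg (Real.log 2), Real.exp_log two_pos]
    have h4 : Real.exp (-(18 * a + 18)) ≤ Real.exp (-Real.sqrt (32 * Real.pi ^ 2 * a ^ 2 + 16 * Real.pi ^ 2 + 12)) := by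
      gcongr
    calc _ = (1 / (2 * R)) * Real.exp (-(18 * a + 18)) := by field_simp
      _ ≤ _ := by gcongr

lemma path_lift {E X : Type*} [TopologicalSpace E] [TopologicalSpace X] {p : E → X}
    (hp : IsLocalHomeomorph p) (sep : IsSeparatedMap p) (γ : ℝ → X) (hγ : Continuous γ) (e : E)
    (he : ∀ t ≤ 0, γ t = p e)
    (hcl : ∀ T : ℝ, 0 ≤ T → T ≤ 1 → ∀ Γ : ℝ → E, ContinuousOn Γ (Iio T) →
      (∀ s < T, p (Γ s) = γ s) → ∃ e' : E, p e' = γ T ∧ MapClusterPt e' (𝓝[<] T) Γ) :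
    ∃ Γ : ℝ → E, ContinuousOn Γ (Iic 1) ∧ (∀ s ≤ 1, p (Γ s) = γ s) ∧ Γ 0 = e := by
  set L : ℝ → (ℝ → E) → Prop := fun t Γ => ContinuousOn Γ (Iic t) ∧ (∀ s ≤ t, p (Γ s) = γ s) ∧
    ∀ s ≤ -1, Γ s = e with hL
  have inj := hp.isLocallyInjective
  have uniq : ∀ t t' Γ Γ', L t Γ → L t' Γ' → ∀ s, s ≤ t → s ≤ t' → Γ s = Γ' s := by
    intro t t' Γ Γ' h h' s hs hs'
    refine sep.eqOn_of_comp_eqOn inj (s := Iic s) isPreconnected_Iic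
      (h.1.mono (Iic_subset_Iic.2 hs)) (h'.1.mono (Iic_subset_Iic.2 hs')) ?_
      (a := min s (-1)) (mem_Iic.2 (min_le_left _ _)) ?_ (mem_Iic.2 le_rfl)
    · intro r hr
      simp only [Function.comp]
      rw [h.2.1 r (le_trans hr hs), h'.2.1 r (le_trans hr hs')]
    · rw [h.2.2 _ (min_le_right _ _), h'.2.2 _ (min_le_right _ _)]
  set S : Set ℝ := {t | ∃ Γ, L t Γ} with hS
  have hdown : ∀ t ∈ S, ∀ t' ≤ t, t' ∈ S := by
    rintro t ⟨Γ, h1, h2, h3⟩ t' ht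
    exact ⟨Γ, h1.mono (Iic_subset_Iic.2 ht), fun s hs => h2 s (hs.trans ht), h3⟩
  have h0 : (0:ℝ) ∈ S := ⟨fun _ => e, continuousOn_const, fun s hs => (he s hs).symm, fun _ _ => rfl⟩
  have hstep : ∀ T : ℝ, 0 ≤ T → T ≤ 1 → (∀ t < T, t ∈ S) → ∃ T' > T, T' ∈ S := by
    intro T hT0 hT1 hT
    have : ∀ t : ℝ, ∃ Γ, t < T → L t Γ := by
      intro t
      by_cases h : t < T
      · obtain ⟨Γ, h'⟩ := hT t h
        exact ⟨Γ, fun _ => h'⟩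
      · exact ⟨fun _ => e, fun h' => absurd h' h⟩
    choose F hF using this
    set Γ : ℝ → E := fun s => F ((s + T) / 2) s with hΓ
    have hΓeq : ∀ t < T, ∀ s ≤ t, Γ s = F t s := by
      intro t ht s hs
      exact uniq _ _ _ _ (hF ((s + T)/2) (by linarith)) (hF t ht) s (by linarith) hs
    have hΓc : ContinuousOn Γ (Iio T) := by
      intro s hs
      have hs : s < T := hs
      have h1 : ContinuousAt (F ((s+T)/2)) s :=
        (hF ((s+T)/2) (by linarith)).1.continuousAt (Iic_mem_nhds (by linarith))
      apply ContinuousAt.continuousWithinAt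
      apply h1.congr
      filter_upwards [Iic_mem_nhds (show s < (s+T)/2 by linarith)] with r hr
      exact (hΓeq _ (by linarith) r hr).symm
    have hΓl : ∀ s < T, p (Γ s) = γ s := by
      intro s hs
      exact (hF ((s+T)/2) (by linarith)).2.1 s (by linarith)
    have hΓe : ∀ s ≤ -1, Γ s = e := by
      intro s hs
      exact (hF ((s+T)/2) (by linarith)).2.2 s hs
    obtain ⟨e', he', hcp⟩ := hcl T hT0 hT1 Γ hΓc hΓl
    obtain ⟨q, hq1, hq2⟩ := hp e'
    have htgt : γ ⁻¹' q.target ∈ 𝓝 T := by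
      apply hγ.continuousAt.preimage_mem_nhds
      rw [← he', hq2]
      exact q.open_target.mem_nhds (q.map_source hq1)
    obtain ⟨ε, hε, hball⟩ := Metric.mem_nhds_iff.1 htgt
    have hfreq := (mapClusterPt_iff_frequently.1 hcp) q.source (q.open_source.mem_nhds hq1)
    have hev : ∀ᶠ s in 𝓝[<] T, max (T - ε) (-1) < s ∧ s < T := by
      have : Ioo (max (T - ε) (-1)) T ∈ 𝓝[<] T := Ioo_mem_nhdsLT (by
        rw [max_lt_iff]; constructor <;> linarith)
      exact this
    obtain ⟨s0, hs0, hs1, hs2⟩ := (hfreq.and_eventually hev).exists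
    rw [max_lt_iff] at hs1
    have hin : ∀ s, s0 ≤ s → s ≤ T + ε / 2 → γ s ∈ q.target := by
      intro s h1 h2
      apply hball
      rw [Metric.mem_ball, Real.dist_eq, abs_lt]
      constructor <;> linarith
    refine ⟨T + ε / 2, by linarith, fun s => if s ≤ s0 then Γ s else q.symm (γ s), ?_, ?_, ?_⟩
    · apply ContinuousOn.if
      · intro a ha
        have : a = s0 := by
          have := ha.2
          change a ∈ frontier (Iic s0) at this
          rw [frontier_Iic] at this
          exact this
        subst this
        rw [← hΓl a hs2, hq2, q.left_inv hs0]
      · apply hΓc.mono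
        intro a ha
        have := ha.2
        change a ∈ closure (Iic s0) at this
        rw [closure_Iic] at this
        exact lt_of_le_of_lt this hs2
      · apply q.continuousOn_symm.comp hγ.continuousOn
        intro a ha
        have := ha.2
        have h2 : {a | ¬ a ≤ s0} = Ioi s0 := by ext; simp
        rw [h2, closure_Ioi] at this
        exact hin a this ha.1
    · intro s hs
      by_cases h : s ≤ s0
      · simp only [h, if_true]
        exact hΓl s (by linarith)
      · simp only [h, if_false]
        rw [hq2, q.right_inv (hin s (by linarith) hs)]
    · intro s hs
      have : s ≤ s0 := by linarith
      simp only [this, if_true]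
      exact hΓe s hs
  have h1 : (1:ℝ) ∈ S := by
    by_contra h
    have hub : ∀ t ∈ S, t ≤ 1 := by
      intro t ht
      by_contra h'
      exact h (hdown t ht 1 (by linarith))
    have hbdd : BddAbove S := ⟨1, hub⟩
    obtain ⟨T', hT', hT'S⟩ := hstep (sSup S) (le_csSup hbdd h0) (csSup_le ⟨0, h0⟩ hub) (by
      intro t ht
      obtain ⟨b, hb, hb'⟩ := exists_lt_of_lt_csSup ⟨0, h0⟩ ht
      exact hdown b hb t hb'.le)
    exact absurd (le_csSup hbdd hT'S) (by linarith)
  obtain ⟨Γ, h1, h2, h3⟩ := h1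
  refine ⟨Γ, h1, h2, ?_⟩
  rw [← h3 (-1) le_rfl]
  refine sep.constOn_of_comp inj (s := Iic 0) isPreconnected_Iic (h1.mono (Iic_subset_Iic.2 zero_le_one)) ?_
    (by simp) (by simp)
  intro a ha b hb
  rw [h2 a (le_trans ha zero_le_one), h2 b (le_trans hb zero_le_one), he a ha, he b hb]

lemma mero_isolated {f : ℂ → ℂ} {P : Set ℂ} (hm : MeroPlane f P) (z : ℂ) :
    ∀ᶠ y in 𝓝[≠] z, y ∉ P := by
  have hfin := (hm.1 (Metric.closedBall z 1) (isCompact_closedBall z 1)).subset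
    (sdiff_subset (t := {z}))
  have h1 := hfin.isClosed.isOpen_compl.mem_nhds (x := z) (by simp)
  rw [eventually_nhdsWithin_iff]
  filter_upwards [h1, Metric.closedBall_mem_nhds z one_pos] with y hy hy' hne hP
  exact hy ⟨⟨hP, hy'⟩, hne⟩

lemma mero_closed {f : ℂ → ℂ} {P : Set ℂ} (hm : MeroPlane f P) : IsClosed P := by
  rw [← isOpen_compl_iff, isOpen_iff_mem_nhds]
  intro z hz
  have := mero_isolated hm z
  rw [eventually_nhdsWithin_iff] at this
  filter_upwards [this] with y hy
  by_cases h : y = z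
  · rwa [h]
  · exact hy h

lemma mero_pole {f : ℂ → ℂ} {P : Set ℂ} (hm : MeroPlane f P) {p : ℂ} (hp : p ∈ P) :
    Tendsto (fun z => ‖f z‖) (𝓝[≠] p) atTop := by
  refine (hm.2.2 p hp).mono_left ?_
  rw [nhdsWithin, nhdsWithin]
  refine le_inf inf_le_left ?_
  rw [le_principal_iff]
  exact mero_isolated hm p

lemma omega_open {f : ℂ → ℂ} {P : Set ℂ} (hm : MeroPlane f P) (R : ℝ) :
    IsOpen {z : ℂ | z ∈ P ∨ R < ‖f z‖} := by
  rw [isOpen_iff_mem_nhds]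
  intro z hz
  by_cases hP : z ∈ P
  · have := (mero_pole hm hP).eventually_gt_atTop R
    rw [eventually_nhdsWithin_iff] at this
    filter_upwards [this] with y hy
    by_cases h : y = z
    · left; rwa [h]
    · right; exact hy h
  · have h1 : R < ‖f z‖ := hz.resolve_left hP
    have := (hm.2.1 z hP).continuousAt.norm.eventually (lt_mem_nhds h1)
    filter_upwards [this] with y hy using Or.inr hy

lemma comp_closure {Ω U : Set ℂ} (hΩ : IsOpen Ω) (hU : IsComponentOf U Ω) {z : ℂ}
    (hz : z ∈ closure U) (hzΩ : z ∈ Ω) : z ∈ U := by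
  obtain ⟨x, hx, rfl⟩ := hU
  have h1 : connectedComponentIn Ω z ∈ 𝓝 z :=
    hΩ.connectedComponentIn.mem_nhds (mem_connectedComponentIn hzΩ)
  obtain ⟨y, hy1, hy2⟩ := mem_closure_iff_nhds.1 hz _ h1
  rw [connectedComponentIn_eq hy2, ← connectedComponentIn_eq hy1]
  exact mem_connectedComponentIn hzΩ

lemma mero_compl_preconnected {f : ℂ → ℂ} {P : Set ℂ} (hm : MeroPlane f P) :
    IsPreconnected Pᶜ := by
  have hc : P.Countable := by
    have : P = ⋃ n : ℕ, P ∩ Metric.closedBall 0 n := by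
      rw [← inter_iUnion, Metric.iUnion_closedBall_nat, inter_univ]
    rw [this]
    exact countable_iUnion fun n => (hm.1 _ (isCompact_closedBall _ _)).countable
  exact (hc.isConnected_compl_of_one_lt_rank (by
    rw [Complex.rank_real_complex]; norm_num)).isPreconnected

lemma mero_deriv_ne {f : ℂ → ℂ} {P : Set ℂ} {R : ℝ} (hf : TranscMeroPlane f P)
    (hcrit : ∀ w : ℂ, some w ∈ CriticalValues f P → norm w ≤ R) {z : ℂ} (hz : z ∉ P)
    (hzR : R < ‖f z‖) : deriv f z ≠ 0 := by
  intro h0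
  obtain ⟨hm, hrat⟩ := hf
  have ha := hm.2.1 z hz
  by_cases hev : ∀ᶠ y in 𝓝 z, deriv f y = 0
  · apply hrat
    have hA : AnalyticOnNhd ℂ (deriv f) Pᶜ := fun y hy => (hm.2.1 y hy).deriv
    have h1 : EqOn (deriv f) 0 Pᶜ :=
      hA.eqOn_zero_of_preconnected_of_eventuallyEq_zero (mero_compl_preconnected hm) hz hev
    have h2 : ∀ y ∉ P, f y = f z := fun y hy => (mero_closed hm).isOpen_compl.is_const_of_deriv_eq_zero (mero_compl_preconnected hm)
      (fun y hy => (hm.2.1 y hy).differentiableAt.differentiableWithinAt) h1 hy hz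
    refine ⟨Polynomial.C (f z), 1, one_ne_zero, fun y hy _ => ?_⟩
    rw [h2 y hy]; simp
  · obtain ⟨n, g, hg, hg0, hgn⟩ := (ha.deriv.exists_eventuallyEq_pow_smul_nonzero_iff).2 hev
    have hn : 0 < n := by
      rcases Nat.eq_zero_or_pos n with h | h
      · exfalso
        have := hgn.self_of_nhds
        rw [h0, h] at this
        simp at this
        exact hg0 this.symm
      · exact h
    have := hcrit (f z) ⟨z, ⟨n + 1, by omega, Or.inr ⟨ha, ?_⟩⟩, ?_⟩
    · linarith
    · rw [Nat.add_sub_cancel]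
      exact ⟨hn, g, hg, hg0, hgn⟩
    · simp [valueAt, hz]

lemma mapCluster_unique {α X : Type*} [TopologicalSpace X] [T2Space X] {F : Filter α} {u : α → X}
    {x y : X} (h : MapClusterPt x F u) (hy : Tendsto u F (𝓝 y)) : x = y := by
  have : NeBot (𝓝 x ⊓ 𝓝 y) := by
    have h : NeBot (𝓝 x ⊓ map u F) := h
    exact h.mono (inf_le_inf_left _ hy)
  exact eq_of_nhds_neBot this

lemma local_homeo {f : ℂ → ℂ} {U : Set ℂ} (hU : IsOpen U) (ha : ∀ z ∈ U, AnalyticAt ℂ f z)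
    (hd : ∀ z ∈ U, deriv f z ≠ 0) : IsLocalHomeomorph (fun u : U => f u) := by
  have h1 : IsLocalHomeomorphOn f U := by
    apply IsLocalHomeomorphOn.mk
    intro z hz
    have h2 : HasStrictDerivAt f (deriv f z) z := (ha z hz).hasStrictDerivAt
    have h3 := h2.hasStrictFDerivAt_equiv (hd z hz)
    exact ⟨h3.toOpenPartialHomeomorph f, h3.mem_toOpenPartialHomeomorph_source, fun y _ => rfl⟩
  rw [isLocalHomeomorph_iff_isLocalHomeomorphOn_univ]
  exact h1.comp hU.isOpenEmbedding_subtypeVal.isLocalHomeomorph.isLocalHomeomorphOn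
    (fun u _ => u.2)

lemma cluster_lift {f : ℂ → ℂ} {P : Set ℂ} {R : ℝ} (hm : MeroPlane f P)
    (hasym : ∀ (w : ℂ) (γ : ℝ → ℂ), AsymptoticPath f P (some w) γ → norm w ≤ R)
    {U : Set ℂ} (hU : IsComponentOf U {z : ℂ | z ∈ P ∨ R < norm (f z)})
    (hUpoles : ∀ z ∈ U, z ∉ P) (γ : ℝ → ℂ) (hγ : Continuous γ) (T : ℝ) (hT : R < ‖γ T‖)
    (Γ : ℝ → U) (hΓ : ContinuousOn Γ (Iio T)) (hl : ∀ s < T, f (Γ s) = γ s) :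
    ∃ e : U, f e = γ T ∧ MapClusterPt e (𝓝[<] T) Γ := by
  have hfT : Tendsto (fun s => f (Γ s)) (𝓝[<] T) (𝓝 (γ T)) := by
    have : Tendsto γ (𝓝[<] T) (𝓝 (γ T)) := hγ.continuousAt.mono_left nhdsWithin_le_nhds
    apply this.congr'
    filter_upwards [self_mem_nhdsWithin] with s hs using (hl s hs).symm
  by_cases hinf : Tendsto (fun s => ‖(Γ s : ℂ)‖) (𝓝[<] T) atTop
  · exfalso
    have hr : Tendsto (fun t : ℝ => T - 1 / (1 + t)) atTop (𝓝[<] T) := by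
      apply tendsto_nhdsWithin_of_tendsto_nhds_of_eventually_within
      · have h1 : Tendsto (fun t : ℝ => 1 + t) atTop atTop := tendsto_atTop_add_const_left _ _ tendsto_id
        have h2 := (tendsto_const_nhds (x := T)).sub (h1.inv_tendsto_atTop)
        simpa using h2
      · filter_upwards [eventually_ge_atTop 0] with t ht
        have : 0 < 1 / (1 + t) := by positivity
        exact show T - 1 / (1 + t) < T by linarith
    refine absurd (hasym (γ T) (fun t => Γ (T - 1 / (1 + t))) ⟨?_, hinf.comp hr, ?_⟩) (not_le.2 hT)
    · apply continuous_subtype_val.comp_continuousOn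
      apply hΓ.comp
      · apply ContinuousOn.sub continuousOn_const
        apply ContinuousOn.div continuousOn_const (by fun_prop)
        intro t ht
        have ht : 0 ≤ t := ht
        positivity
      · intro t ht
        have ht : 0 ≤ t := ht
        have : 0 < 1 / (1 + t) := by positivity
        exact show T - 1 / (1 + t) < T by linarith
    · have hc : Continuous (fun y : ℂ => ‖y - γ T‖ / Real.sqrt ((1 + ‖y‖ ^ 2) * (1 + ‖γ T‖ ^ 2))) := by
        apply Continuous.div (by fun_prop) (by fun_prop)
        intro y
        positivity
      have := (hc.tendsto (γ T)).comp (hfT.comp hr)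
      simp only [sub_self, norm_zero, zero_div] at this
      refine this.congr ?_
      intro t
      simp only [Function.comp, valueAt, hUpoles _ (Γ (T - 1 / (1 + t))).2, if_false, chordal]
  · rw [tendsto_atTop] at hinf
    push Not at hinf
    obtain ⟨M, hM⟩ := hinf
    have hM' : ∃ᶠ s in 𝓝[<] T, (Γ s : ℂ) ∈ Metric.closedBall (0:ℂ) M :=
      hM.mono fun s hs => by rw [mem_closedBall_zero_iff]; exact hs.le
    obtain ⟨z, -, hz⟩ := (isCompact_closedBall (0:ℂ) M).exists_mapClusterPt_of_frequently hM'
    have hzc : z ∈ closure U := by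
      rw [mem_closure_iff_nhds]
      intro t ht
      obtain ⟨s, hs⟩ := (mapClusterPt_iff_frequently.1 hz t ht).exists
      exact ⟨_, hs, (Γ s).2⟩
    have hzP : z ∉ P := by
      intro hP
      have h1 := (mero_pole hm hP).eventually_gt_atTop (‖γ T‖ + 1)
      rw [eventually_nhdsWithin_iff] at h1
      have h2 := mapClusterPt_iff_frequently.1 hz _ h1
      have h3 : ∀ᶠ s in 𝓝[<] T, ‖f (Γ s)‖ < ‖γ T‖ + 1 :=
        hfT.norm.eventually (gt_mem_nhds (by linarith))
      obtain ⟨s, hs1, hs2⟩ := (h2.and_eventually h3).exists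
      have hne : (Γ s : ℂ) ≠ z := fun h => hUpoles _ (Γ s).2 (h ▸ hP)
      have := hs1 hne
      linarith
    have hfz : f z = γ T := by
      have := hz.continuousAt_comp (hm.2.1 z hzP).continuousAt
      exact mapCluster_unique this hfT
    have hzU : z ∈ U := comp_closure (omega_open hm R) hU hzc (Or.inr (by rw [hfz]; exact hT))
    refine ⟨⟨z, hzU⟩, hfz, ?_⟩
    rw [mapClusterPt_iff_frequently]
    intro s hs
    rw [nhds_subtype, mem_comap] at hs
    obtain ⟨t, ht, hts⟩ := hs
    exact (mapClusterPt_iff_frequently.1 hz t ht).mono fun r hr => hts hr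

lemma exists_G {f : ℂ → ℂ} {P : Set ℂ} {R : ℝ} (hR : 1 ≤ R) (hf : TranscMeroPlane f P)
    (hcrit : ∀ w : ℂ, some w ∈ CriticalValues f P → norm w ≤ R)
    (hasym : ∀ (w : ℂ) (γ : ℝ → ℂ), AsymptoticPath f P (some w) γ → norm w ≤ R)
    {U : Set ℂ} (hU : IsComponentOf U {z : ℂ | z ∈ P ∨ R < norm (f z)})
    (hUpoles : ∀ z ∈ U, z ∉ P) (z : ℂ) (hz : z ∈ U) (ζ : ℂ) (hζ : Complex.exp ζ = f z) :
    ∃ G : ℂ → ℂ, (∀ a, Real.log R < a.re → G a ∈ U ∧ f (G a) = Complex.exp a) ∧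
      DifferentiableOn ℂ G {a | Real.log R < a.re} ∧ G ζ = z := by
  have hm := hf.1
  have hUo : IsOpen U := by
    obtain ⟨x, hx, rfl⟩ := hU
    exact (omega_open hm R).connectedComponentIn
  have hUR : ∀ y ∈ U, R < ‖f y‖ := by
    intro y hy
    have : y ∈ {z : ℂ | z ∈ P ∨ R < norm (f z)} := by
      obtain ⟨x, hx, rfl⟩ := hU
      exact connectedComponentIn_subset _ _ hy
    exact this.resolve_left (hUpoles y hy)
  have hUa : ∀ y ∈ U, AnalyticAt ℂ f y := fun y hy => hm.2.1 y (hUpoles y hy)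
  have hUd : ∀ y ∈ U, deriv f y ≠ 0 := fun y hy => mero_deriv_ne hf hcrit (hUpoles y hy) (hUR y hy)
  have hR0 : 0 < R := by linarith
  have hexpR : ∀ a : ℂ, Real.log R < a.re ↔ R < ‖Complex.exp a‖ := by
    intro a
    rw [Complex.norm_exp, Real.log_lt_iff_lt_exp hR0]
  set H : Set ℂ := {a | Real.log R < a.re} with hH
  have hHo : IsOpen H := isOpen_lt continuous_const Complex.continuous_re
  have hHc : Convex ℝ H := convex_halfSpace_re_gt _
  have hζH : ζ ∈ H := by
    rw [hH, mem_ofPred, hexpR, hζ]; exact hUR z hz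
  have hp := local_homeo hUo hUa hUd
  have sep : IsSeparatedMap (fun u : U => f u) := T2Space.isSeparatedMap _
  set γ : ℂ → ℝ → ℂ := fun a t => Complex.exp (ζ + (max t 0 : ℝ) * (a - ζ)) with hγ
  have hγc : ∀ a, Continuous (γ a) := by
    intro a
    simp only [hγ]
    fun_prop
  have hlift : ∀ a : H, ∃ Γ : ℝ → U, ContinuousOn Γ (Iic 1) ∧ (∀ s ≤ 1, f (Γ s) = γ a s) ∧
      Γ 0 = ⟨z, hz⟩ := by
    intro a
    refine path_lift hp sep (γ a) (hγc a) ⟨z, hz⟩ ?_ ?_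
    · intro t ht
      simp only [hγ, max_eq_right ht]
      simp [hζ]
    · intro T hT0 hT1 Γ hΓ hl
      refine cluster_lift hm hasym hU hUpoles (γ a) (hγc a) T ?_ Γ hΓ hl
      simp only [hγ]
      rw [← hexpR]
      have : ζ + T * (a - ζ) ∈ H := by
        have := hHc.add_smul_sub_mem hζH a.2 ⟨hT0, hT1⟩
        simpa using this
      rw [max_eq_left hT0]
      exact this
  choose Γ hΓc hΓl hΓ0 using hlift
  set g : unitInterval × H → U := fun q => Γ q.2 q.1 with hg
  set F : C(unitInterval × H, ℂ) := ⟨fun q => Complex.exp (ζ + ((q.1 : ℝ) : ℂ) * (q.2 - ζ)), by fun_prop⟩ with hF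
  have hgF : ∀ q, f (g q) = F q := by
    rintro ⟨t, a⟩
    simp only [hg, hF]
    rw [hΓl a t t.2.2]
    simp only [hγ, max_eq_left t.2.1]
    rfl
  have hgA : ∀ a, Continuous (fun t => g (t, a)) := by
    intro a
    exact (hΓc a).comp_continuous continuous_subtype_val (fun t => t.2.2)
  have hgc : Continuous g := by
    refine hp.continuous_lift sep F (funext hgF) ?_ hgA
    simp only [hg]
    have : (fun a : H => Γ a ((0 : unitInterval) : ℝ)) = fun _ => ⟨z, hz⟩ := by
      ext a
      simp [hΓ0]
    rw [this]
    exact continuous_const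
  classical
  set G : ℂ → ℂ := fun a => if h : a ∈ H then (g (1, ⟨a, h⟩) : ℂ) else 0 with hG
  have hGU : ∀ a ∈ H, G a ∈ U := by
    intro a ha
    simp only [hG, ha, dif_pos]
    exact (g (1, ⟨a, ha⟩)).2
  have hGf : ∀ a ∈ H, f (G a) = Complex.exp a := by
    intro a ha
    simp only [hG, ha, dif_pos]
    rw [hgF]
    simp [hF]
  have hGc : ContinuousOn G H := by
    rw [continuousOn_iff_continuous_domRestrict]
    have : H.domRestrict G = fun a : H => (g (1, a) : ℂ) := by
      ext a
      simp [hG]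
    rw [this]
    fun_prop
  refine ⟨G, fun a ha => ⟨hGU a ha, hGf a ha⟩, ?_, ?_⟩
  · intro a ha
    apply DifferentiableAt.differentiableWithinAt
    have hnh := hHo.mem_nhds ha
    have h1 : HasStrictDerivAt f (deriv f (G a)) (G a) := (hUa _ (hGU a ha)).hasStrictDerivAt
    have h2 := h1.to_localInverse (hUd _ (hGU a ha))
    have h3 := (hGc.continuousAt hnh).eventually (h1.eventually_left_inverse (hUd _ (hGU a ha)))
    rw [hGf a ha] at h2
    have h4 : DifferentiableAt ℂ (fun b => h1.localInverse f (deriv f (G a)) (G a) (hUd _ (hGU a ha)) (Complex.exp b)) a :=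
      DifferentiableAt.comp a h2.hasDerivAt.differentiableAt Complex.differentiableAt_exp
    apply h4.congr_of_eventuallyEq
    filter_upwards [h3, hnh] with b hb hb'
    rw [← hGf b hb', hb]
  · simp only [hG, hζH, dif_pos]
    have := sep.const_of_comp hp.isLocallyInjective (hgA ⟨ζ, hζH⟩) (by
      intro s t
      rw [hgF, hgF]
      simp [hF]) 1 0
    rw [this]
    simp [hg, hΓ0]

lemma poly_of_growth {F : ℂ → ℂ} (hF : Differentiable ℂ F) {N : ℕ} {C ρ : ℝ}
    (hg : ∀ z : ℂ, ρ < ‖z‖ → ‖F z‖ ≤ C * ‖z‖ ^ N) : ∃ p : Polynomial ℂ, ∀ z, F z = p.eval z := by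
  have hz : ∀ n, N < n → iteratedDeriv n F 0 = 0 := by
    intro n hn
    have hb : ∀ᶠ r : ℝ in atTop, ‖iteratedDeriv n F 0‖ ≤ (n.factorial * C) * r⁻¹ := by
      filter_upwards [eventually_gt_atTop ρ, eventually_ge_atTop 1] with r hr hr1
      have hr0 : 0 < r := by linarith
      have h1 := Complex.norm_iteratedDeriv_le_of_forall_mem_sphere_norm_le (c := 0) (C := C * r ^ N)
        n hr0 hF.diffContOnCl (by
          intro z hz
          rw [mem_sphere_zero_iff_norm] at hz
          have := hg z (by rw [hz]; exact hr)
          rwa [hz] at this)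
      have hC : 0 ≤ C := by
        have := (norm_nonneg _).trans (hg (r : ℂ) (by
          rw [Complex.norm_real, Real.norm_of_nonneg hr0.le]; exact hr))
        rw [Complex.norm_real, Real.norm_of_nonneg hr0.le] at this
        by_contra h
        push Not at h
        have := mul_neg_of_neg_of_pos h (pow_pos hr0 N)
        linarith
      refine h1.trans ?_
      rw [div_le_iff₀ (by positivity)]
      have h2 : r ^ N ≤ r⁻¹ * r ^ n := by
        obtain ⟨m, rfl⟩ := Nat.exists_eq_add_of_lt hn
        have : r⁻¹ * r ^ (N + m + 1) = r ^ (N + m) := by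
          rw [pow_succ]; field_simp
        rw [this]
        exact pow_le_pow_right₀ hr1 (by omega)
      calc _ = (n.factorial * C) * r ^ N := by ring
        _ ≤ (n.factorial * C) * (r⁻¹ * r ^ n) := by gcongr
        _ = _ := by ring
    have ht : Tendsto (fun r : ℝ => (n.factorial * C) * r⁻¹) atTop (𝓝 0) := by
      simpa using (tendsto_inv_atTop_zero (𝕜 := ℝ)).const_mul (n.factorial * C)
    have := ge_of_tendsto ht hb
    exact norm_le_zero_iff.1 this
  refine ⟨∑ n ∈ Finset.range (N + 1), Polynomial.C ((n.factorial : ℂ)⁻¹ * iteratedDeriv n F 0) * Polynomial.X ^ n, ?_⟩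
  intro z
  rw [Polynomial.eval_finsetSum, ← Complex.taylorSeries_eq_of_entire' (c := 0) (z := z) hF]
  rw [tsum_eq_sum (s := Finset.range (N + 1))]
  · simp
  · intro n hn
    rw [hz n (by simpa using hn)]
    simp

lemma poly_growth (Q : Polynomial ℂ) (z : ℂ) (hz : 1 ≤ ‖z‖) :
    ‖Q.eval z‖ ≤ (∑ i ∈ Finset.range (Q.natDegree + 1), ‖Q.coeff i‖) * ‖z‖ ^ Q.natDegree := by
  rw [Polynomial.eval_eq_sum_range, Finset.sum_mul]
  refine (norm_sum_le _ _).trans (Finset.sum_le_sum fun i hi => ?_)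
  rw [norm_mul, norm_pow]
  gcongr
  simpa [Nat.lt_succ_iff] using hi

lemma pole_merom {f : ℂ → ℂ} {P : Set ℂ} (hm : MeroPlane f P) {p : ℂ} (hp : p ∈ P) :
    ∃ n : ℕ, AnalyticAt ℂ (fun z => (z - p) ^ n * f z) p := by
  have hpole := mero_pole hm hp
  have h1 : ∀ᶠ z in 𝓝[≠] p, f z ≠ 0 := by
    filter_upwards [hpole.eventually_gt_atTop 0] with z hz using norm_pos_iff.1 hz
  have h2 : Tendsto (fun z => (f z)⁻¹) (𝓝[≠] p) (𝓝 0) := by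
    rw [tendsto_zero_iff_norm_tendsto_zero]
    simp only [norm_inv]
    exact hpole.inv_tendsto_atTop
  set g : ℂ → ℂ := Function.update (fun z => (f z)⁻¹) p 0 with hg
  have hge : ∀ᶠ z in 𝓝[≠] p, g z = (f z)⁻¹ := by
    filter_upwards [self_mem_nhdsWithin] with z hz
    exact Function.update_of_ne hz _ _
  have hgd : ∀ᶠ z in 𝓝[≠] p, DifferentiableAt ℂ g z := by
    filter_upwards [mero_isolated hm p, h1, self_mem_nhdsWithin] with z hz hz1 hz2
    have h3 : DifferentiableAt ℂ (fun z => (f z)⁻¹) z := (hm.2.1 z hz).differentiableAt.inv hz1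
    apply h3.congr_of_eventuallyEq
    filter_upwards [isOpen_ne.mem_nhds hz2] with y hy
    exact Function.update_of_ne hy _ _
  have hga : AnalyticAt ℂ g p := by
    apply Complex.analyticAt_of_differentiable_on_punctured_nhds_of_continuousAt hgd
    rw [hg, continuousAt_update_same]
    exact h2
  have hfm : MeromorphicAt f p := by
    apply hga.meromorphicAt.inv.congr
    filter_upwards [hge] with z hz
    rw [Pi.inv_apply, hz, inv_inv]
  exact hfm

lemma rational_of_growth {f : ℂ → ℂ} {P : Set ℂ} (hm : MeroPlane f P) {N : ℕ} {C ρ : ℝ}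
    (hP : ∀ z : ℂ, ρ < ‖z‖ → z ∉ P) (hg : ∀ z : ℂ, ρ < ‖z‖ → ‖f z‖ ≤ C * ‖z‖ ^ N) :
    RationalFn f P := by
  have hfin : P.Finite := by
    apply (hm.1 _ (isCompact_closedBall (0:ℂ) ρ)).subset
    intro z hz
    refine ⟨hz, ?_⟩
    rw [mem_closedBall_zero_iff]
    by_contra h
    exact hP z (by linarith) hz
  have : ∀ p : ℂ, ∃ n : ℕ, p ∈ P → AnalyticAt ℂ (fun z => (z - p) ^ n * f z) p := by
    intro p
    by_cases hp : p ∈ P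
    · obtain ⟨n, hn⟩ := pole_merom hm hp
      exact ⟨n, fun _ => hn⟩
    · exact ⟨0, fun h => absurd h hp⟩
  choose n hn using this
  set Q : Polynomial ℂ := ∏ p ∈ hfin.toFinset, (Polynomial.X - Polynomial.C p) ^ n p with hQ
  have hQ0 : Q ≠ 0 := by
    rw [hQ, Finset.prod_ne_zero_iff]
    intro p _
    exact pow_ne_zero _ (Polynomial.X_sub_C_ne_zero p)
  have hQa : ∀ (A : Polynomial ℂ) z, AnalyticAt ℂ (fun y => A.eval y) z := by
    intro A z
    exact (Polynomial.differentiable A).analyticAt z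
  have hF : Differentiable ℂ (fun z => Q.eval z * f z) := by
    intro z
    by_cases hz : z ∈ P
    · have hmem : z ∈ hfin.toFinset := by simpa using hz
      set A : Polynomial ℂ := ∏ p ∈ hfin.toFinset.erase z, (Polynomial.X - Polynomial.C p) ^ n p
      have : (fun y => Q.eval y * f y) = fun y => A.eval y * ((y - z) ^ n z * f y) := by
        ext y
        rw [hQ, ← Finset.prod_erase_mul _ _ hmem, Polynomial.eval_mul]
        simp only [Polynomial.eval_pow, Polynomial.eval_sub, Polynomial.eval_X, Polynomial.eval_C]
        ring
      rw [this]
      exact ((hQa A z).mul (hn z hz)).differentiableAt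
    · exact ((hQa Q z).mul (hm.2.1 z hz)).differentiableAt
  obtain ⟨p, hp⟩ := poly_of_growth hF (N := Q.natDegree + N)
    (C := (∑ i ∈ Finset.range (Q.natDegree + 1), ‖Q.coeff i‖) * C) (ρ := max ρ 1) (by
      intro z hz
      rw [max_lt_iff] at hz
      rw [norm_mul]
      calc _ ≤ ((∑ i ∈ Finset.range (Q.natDegree + 1), ‖Q.coeff i‖) * ‖z‖ ^ Q.natDegree) * (C * ‖z‖ ^ N) := by
            gcongr
            · exact poly_growth Q z hz.2.le
            · exact hg z hz.1
        _ = _ := by rw [pow_add]; ring)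
  refine ⟨p, Q, hQ0, fun z _ hz => ?_⟩
  rw [← hp z]
  field_simp

lemma G_tendsto {f : ℂ → ℂ} {P : Set ℂ} {R : ℝ} (hm : MeroPlane f P)
    {U : Set ℂ} (hU : IsComponentOf U {z : ℂ | z ∈ P ∨ R < norm (f z)})
    (hUpoles : ∀ z ∈ U, z ∉ P) {G : ℂ → ℂ}
    (hG : ∀ a, Real.log R < a.re → G a ∈ U ∧ f (G a) = Complex.exp a) :
    Tendsto (fun a => ‖G a‖) (comap Complex.re atTop) atTop := by
  by_contra hinf
  rw [tendsto_atTop] at hinf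
  push Not at hinf
  obtain ⟨M, hM⟩ := hinf
  have hM' : ∃ᶠ s in comap Complex.re atTop, G s ∈ Metric.closedBall (0:ℂ) M :=
    hM.mono fun s hs => by rw [mem_closedBall_zero_iff]; exact hs.le
  obtain ⟨z, -, hz⟩ := (isCompact_closedBall (0:ℂ) M).exists_mapClusterPt_of_frequently hM'
  have hre : Tendsto Complex.re (comap Complex.re atTop) atTop := tendsto_comap
  have hH := hre.eventually_gt_atTop (Real.log R)
  have hzc : z ∈ closure U := by
    rw [mem_closure_iff_nhds]
    intro t ht
    obtain ⟨s, hs, hs'⟩ := ((mapClusterPt_iff_frequently.1 hz t ht).and_eventually hH).exists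
    exact ⟨_, hs, (hG s hs').1⟩
  have hzP : z ∉ P := fun hP => hUpoles z (comp_closure (omega_open hm R) hU hzc (Or.inl hP)) hP
  have h1 := (hm.2.1 z hzP).continuousAt.norm.eventually (gt_mem_nhds (show ‖f z‖ < ‖f z‖ + 1 by linarith))
  have h2 := mapClusterPt_iff_frequently.1 hz _ h1
  have h3 := (Real.tendsto_exp_atTop.comp hre).eventually_gt_atTop (‖f z‖ + 1)
  obtain ⟨s, hs, hs1, hs2⟩ := (h2.and_eventually (hH.and h3)).exists
  have hs : ‖f (G s)‖ < ‖f z‖ + 1 := hs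
  rw [(hG s hs1).2, Complex.norm_exp] at hs
  simp only [Function.comp] at hs2
  linarith

lemma G_periodic {f : ℂ → ℂ} {R : ℝ}
    {U : Set ℂ} (hUa : ∀ y ∈ U, AnalyticAt ℂ f y) (hUd : ∀ y ∈ U, deriv f y ≠ 0) {G : ℂ → ℂ}
    (hG : ∀ a, Real.log R < a.re → G a ∈ U ∧ f (G a) = Complex.exp a)
    (hGd : DifferentiableOn ℂ G {a | Real.log R < a.re}) {a τ : ℂ} (ha : Real.log R < a.re)
    (hτ : τ.re = 0) (hτe : Complex.exp τ = 1) (hab : G (a + τ) = G a) :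
    ∀ b, Real.log R < b.re → G (b + τ) = G b := by
  set H : Set ℂ := {a | Real.log R < a.re} with hH
  have hHo : IsOpen H := isOpen_lt continuous_const Complex.continuous_re
  have hHc : Convex ℝ H := convex_halfSpace_re_gt _
  have hadd : ∀ b ∈ H, b + τ ∈ H := by
    intro b hb
    change Real.log R < (b + τ).re
    rw [Complex.add_re, hτ, add_zero]; exact hb
  have h1 : AnalyticOnNhd ℂ G H := hGd.analyticOnNhd hHo
  have h2d : DifferentiableOn ℂ (fun b => G (b + τ)) H :=
    hGd.comp (f := fun b => b + τ) (by fun_prop) hadd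
  have h2 : AnalyticOnNhd ℂ (fun b => G (b + τ)) H := h2d.analyticOnNhd hHo
  have hev : (fun b => G (b + τ)) =ᶠ[𝓝 a] G := by
    have hs : HasStrictDerivAt f (deriv f (G a)) (G a) := (hUa _ (hG a ha).1).hasStrictDerivAt
    have hl := hs.eventually_left_inverse (hUd _ (hG a ha).1)
    have e1 := (h1 a ha).continuousAt.eventually hl
    have c2 := (h2 a ha).continuousAt
    have e2 := c2.eventually (p := fun y => hs.localInverse f (deriv f (G a)) (G a) (hUd _ (hG a ha).1) (f y) = y)
      (by simp only [hab]; exact hl)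
    filter_upwards [e1, e2, hHo.mem_nhds ha] with b hb1 hb2 hb3
    rw [← hb1, ← hb2, (hG b hb3).2, (hG _ (hadd b hb3)).2, Complex.exp_add, hτe, mul_one]
  intro b hb
  exact h2.eqOn_of_preconnected_of_eventuallyEq h1 hHc.isPreconnected ha hev hb

lemma G_growth {f : ℂ → ℂ} {R : ℝ} {U : Set ℂ} {G : ℂ → ℂ}
    (hG : ∀ a, Real.log R < a.re → G a ∈ U ∧ f (G a) = Complex.exp a)
    (hGd : DifferentiableOn ℂ G {a | Real.log R < a.re})
    (hGt : Tendsto (fun a => ‖G a‖) (comap Complex.re atTop) atTop) (k : ℕ) (hk : 0 < k)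
    (hper : ∀ b : ℂ, Real.log R < b.re → G (b + 2 * Real.pi * k * Complex.I) = G b) :
    ∃ C ρ : ℝ, ∀ z : ℂ, ρ < ‖z‖ → z ∈ U ∧ ‖f z‖ ≤ C * ‖z‖ ^ k := by
  set φ : ℂ → ℂ := fun w => -(2 * Real.pi * k * Complex.I) * w with hφ
  have hφre : ∀ w, (φ w).re = 2 * Real.pi * k * w.im := by
    intro w
    simp [hφ]
  have hkp : (0:ℝ) < 2 * Real.pi * k := by positivity
  have hφt : Tendsto φ (comap Complex.im atTop) (comap Complex.re atTop) := by
    rw [tendsto_comap_iff]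
    have : Complex.re ∘ φ = fun w => 2 * Real.pi * k * w.im := funext hφre
    rw [this]
    exact tendsto_comap.const_mul_atTop hkp
  have hre : Tendsto Complex.re (comap Complex.re atTop) atTop := tendsto_comap
  have him : Tendsto Complex.im (comap Complex.im atTop) atTop := tendsto_comap
  -- threshold
  have hev : ∀ᶠ a in comap Complex.re atTop, Real.log R < a.re ∧ 0 < ‖G a‖ :=
    (hre.eventually_gt_atTop _).and (hGt.eventually_gt_atTop 0)
  obtain ⟨X, hX⟩ : ∃ X : ℝ, ∀ w : ℂ, X < w.im → Real.log R < (φ w).re ∧ G (φ w) ≠ 0 := by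
    have := hφt.eventually hev
    rw [eventually_comap] at this
    obtain ⟨X, hX⟩ := eventually_atTop.1 this
    refine ⟨X, fun w hw => ?_⟩
    have := hX w.im hw.le w rfl
    exact ⟨this.1, norm_pos_iff.1 this.2⟩
  classical
  set F : ℂ → ℂ := fun w => if X < w.im then (G (φ w))⁻¹ else 0 with hF
  have hFp : Function.Periodic F (1:ℝ) := by
    intro w
    have him1 : (w + ((1:ℝ):ℂ)).im = w.im := by simp
    simp only [hF, him1]
    by_cases h : X < w.im
    · simp only [h, if_true]
      have := hper (φ (w + (1:ℝ))) (by rw [hφre, him1, ← hφre]; exact (hX w h).1)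
      rw [← this]
      congr 2
      simp only [hφ]
      push_cast
      ring
    · simp only [h, if_false]
  have hopen : IsOpen {w : ℂ | X < w.im} := isOpen_lt continuous_const Complex.continuous_im
  have hFd : ∀ᶠ w in comap Complex.im atTop, DifferentiableAt ℂ F w := by
    filter_upwards [him.eventually_gt_atTop X] with w hw
    have h1 : DifferentiableAt ℂ G (φ w) := hGd.differentiableAt
      ((isOpen_lt continuous_const Complex.continuous_re).mem_nhds (hX w hw).1)
    have h2 : DifferentiableAt ℂ (fun w => (G (φ w))⁻¹) w :=
      (DifferentiableAt.comp w h1 (by simp only [hφ]; fun_prop)).inv (hX w hw).2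
    apply h2.congr_of_eventuallyEq
    filter_upwards [hopen.mem_nhds hw] with y hy
    simp only [hF]
    exact if_pos hy
  have hF0 : ZeroAtFilter (comap Complex.im atTop) F := by
    have : Tendsto (fun w => (G (φ w))⁻¹) (comap Complex.im atTop) (𝓝 0) := by
      rw [tendsto_zero_iff_norm_tendsto_zero]
      simp only [norm_inv]
      exact (hGt.comp hφt).inv_tendsto_atTop
    apply this.congr'
    filter_upwards [him.eventually_gt_atTop X] with w hw
    simp only [hF]
    exact (if_pos hw).symm
  set J := Function.Periodic.cuspFunction 1 F with hJ
  have hJ0 : J 0 = 0 := Function.Periodic.cuspFunction_zero_of_zero_at_inf one_pos hF0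
  have hJd : DifferentiableAt ℂ J 0 :=
    Function.Periodic.differentiableAt_cuspFunction_zero one_pos hFp hFd hF0.boundedAtFilter
  have hJd' : ∀ᶠ q in 𝓝[≠] 0, DifferentiableAt ℂ J q :=
    Function.Periodic.eventually_differentiableAt_cuspFunction_nhds_ne_zero one_pos hFp hFd
  have hJa : AnalyticAt ℂ J 0 :=
    Complex.analyticAt_of_differentiable_on_punctured_nhds_of_continuousAt hJd' hJd.continuousAt
  have hJF : ∀ q : ℂ, q ≠ 0 → J q = F (Function.Periodic.invQParam 1 q) :=
    fun q hq => Function.Periodic.cuspFunction_eq_of_nonzero 1 F hq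
  have hqev : ∀ᶠ q in 𝓝[≠] (0:ℂ), X < (Function.Periodic.invQParam 1 q).im :=
    (Function.Periodic.invQParam_tendsto one_pos).eventually (him.eventually_gt_atTop X)
  have hnc : ¬ ∀ᶠ q in 𝓝 (0:ℂ), J q = J 0 := by
    intro h
    have h' := h.filter_mono (nhdsWithin_le_nhds (s := {0}ᶜ))
    obtain ⟨q, hq1, hq2, hq3⟩ := (h'.and (hqev.and self_mem_nhdsWithin)).exists
    have hq3 : q ≠ 0 := hq3
    rw [hJ0, hJF q hq3] at hq1
    simp only [hF, if_pos hq2] at hq1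
    exact (hX _ hq2).2 (inv_eq_zero.1 hq1)
  have hopen2 := hJa.eventually_constant_or_nhds_le_map_nhds.resolve_left hnc
  rw [hJ0] at hopen2
  obtain ⟨C, hC⟩ := hJd.isBigO_sub.bound
  rw [eventually_nhdsWithin_iff] at hqev
  have hgood : ∀ᶠ y in 𝓝 (0:ℂ), ∃ q : ℂ, J q = y ∧ ‖J q‖ ≤ C * ‖q‖ ∧
      (q ≠ 0 → X < (Function.Periodic.invQParam 1 q).im) := by
    apply hopen2
    rw [mem_map]
    filter_upwards [hC, hqev] with q h1 h2
    refine ⟨q, rfl, ?_, h2⟩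
    simpa [hJ0] using h1
  obtain ⟨ε, hε, hball⟩ := Metric.eventually_nhds_iff.1 hgood
  refine ⟨C ^ k, ε⁻¹, fun z hz => ?_⟩
  have hzpos : 0 < ‖z‖ := (inv_pos.2 hε).trans hz
  have hz0 : z ≠ 0 := norm_pos_iff.1 hzpos
  obtain ⟨q, hq1, hq2, hq3⟩ := hball (y := z⁻¹) (by
    rw [dist_zero_right, norm_inv]; exact inv_lt_of_inv_lt₀ hε hz)
  have hq0 : q ≠ 0 := by
    intro h
    rw [h, hJ0] at hq1
    exact inv_ne_zero hz0 hq1.symm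
  have hqX := hq3 hq0
  set w := Function.Periodic.invQParam 1 q with hw
  have hGz : G (φ w) = z := by
    have := hJF q hq0
    rw [hq1] at this
    simp only [hF, ← hw, if_pos hqX] at this
    exact (inv_injective this).symm
  have hH := hG (φ w) (hX w hqX).1
  rw [hGz] at hH
  refine ⟨hH.1, ?_⟩
  have hqn : 0 < ‖q‖ := norm_pos_iff.2 hq0
  have hn : ‖f z‖ = (‖q‖⁻¹) ^ k := by
    rw [hH.2, Complex.norm_exp, hφre, hw, Function.Periodic.im_invQParam]
    have : 2 * Real.pi * k * (-1 / (2 * Real.pi) * Real.log ‖q‖) = k * (Real.log (‖q‖⁻¹)) := by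
      rw [Real.log_inv]
      have := Real.pi_pos
      field_simp
    rw [this, Real.exp_nat_mul, Real.exp_log (by positivity)]
  rw [hn, ← mul_pow]
  apply pow_le_pow_left₀ (by positivity)
  rw [hq1, norm_inv] at hq2
  have h5 := mul_le_mul_of_nonneg_left hq2 hzpos.le
  rw [mul_inv_cancel₀ hzpos.ne'] at h5
  rw [inv_le_iff_one_le_mul₀ hqn]
  linarith

lemma G_inj {f : ℂ → ℂ} {P : Set ℂ} {R : ℝ} (hf : TranscMeroPlane f P)
    (hcrit : ∀ w : ℂ, some w ∈ CriticalValues f P → norm w ≤ R)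
    {U : Set ℂ} (hU : IsComponentOf U {z : ℂ | z ∈ P ∨ R < norm (f z)})
    (hUpoles : ∀ z ∈ U, z ∉ P) {G : ℂ → ℂ}
    (hG : ∀ a, Real.log R < a.re → G a ∈ U ∧ f (G a) = Complex.exp a)
    (hGd : DifferentiableOn ℂ G {a | Real.log R < a.re}) :
    InjOn G {a | Real.log R < a.re} := by
  have hm := hf.1
  have hUR : ∀ y ∈ U, R < ‖f y‖ := by
    intro y hy
    have : y ∈ {z : ℂ | z ∈ P ∨ R < norm (f z)} := by
      obtain ⟨x, hx, rfl⟩ := hU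
      exact connectedComponentIn_subset _ _ hy
    exact this.resolve_left (hUpoles y hy)
  have hUa : ∀ y ∈ U, AnalyticAt ℂ f y := fun y hy => hm.2.1 y (hUpoles y hy)
  have hUd : ∀ y ∈ U, deriv f y ≠ 0 := fun y hy => mero_deriv_ne hf hcrit (hUpoles y hy) (hUR y hy)
  have key : ∀ a : ℂ, Real.log R < a.re → ∀ k : ℕ, 0 < k →
      G (a + 2 * Real.pi * k * Complex.I) ≠ G a := by
    intro a ha k hk hab
    have hper := G_periodic hUa hUd hG hGd (τ := 2 * Real.pi * k * Complex.I) ha (by simp) (by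
      rw [Complex.exp_eq_one_iff]
      exact ⟨k, by push_cast; ring⟩) hab
    obtain ⟨C, ρ, h⟩ := G_growth hG hGd (G_tendsto hm hU hUpoles hG) k hk hper
    exact hf.2 (rational_of_growth hm (fun z hz => hUpoles z (h z hz).1) (fun z hz => (h z hz).2))
  intro a ha b hb hab
  have he : Complex.exp a = Complex.exp b := by
    rw [← (hG a ha).2, ← (hG b hb).2, hab]
  obtain ⟨n, hn⟩ := Complex.exp_eq_exp_iff_exists_int.1 he
  rcases lt_trichotomy n 0 with h | h | h
  · exfalso
    refine key a ha n.natAbs (by omega) ?_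
    rw [hab]
    congr 1
    have : (n.natAbs : ℂ) = -(n : ℂ) := by
      have h' : (n.natAbs : ℤ) = -n := by omega
      rw [← Int.cast_natCast, h', Int.cast_neg]
    rw [hn, this]; ring
  · rw [hn, h]; simp
  · exfalso
    refine key b hb n.natAbs (by omega) ?_
    rw [← hab]
    congr 1
    have : (n.natAbs : ℂ) = (n : ℂ) := by
      have h' : (n.natAbs : ℤ) = n := by omega
      rw [← Int.cast_natCast, h']
    rw [hn, this]; ring

lemma main_bound (R : ℝ) (hR : 1 ≤ R)
    (f : ℂ → ℂ) (Pf : Set ℂ)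
    (hf : TranscMeroPlane f Pf)
    (hcrit : ∀ w : ℂ, some w ∈ CriticalValues f Pf → norm w ≤ R)
    (hasym : ∀ (w : ℂ) (γ : ℝ → ℂ), AsymptoticPath f Pf (some w) γ → norm w ≤ R)
    (U : Set ℂ)
    (hU : IsComponentOf U {z : ℂ | z ∈ Pf ∨ R < norm (f z)})
    (hUpoles : ∀ z ∈ U, z ∉ Pf)
    (z₀ : ℂ) (hz₀ : z₀ ∉ U) (z : ℂ) (hz : z ∈ U) : R < ‖f z‖ ∧ 
      (Real.log (norm (f z) / R)) ^ 2
          ≤ 32 * Real.pi ^ 2 * norm ((z - z₀) ^ 2 * schwarzian f z)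
            + 16 * Real.pi ^ 2 + 12 := by
  have hUR : R < ‖f z‖ := by
    have : z ∈ {z : ℂ | z ∈ Pf ∨ R < norm (f z)} := by
      obtain ⟨x, hx, rfl⟩ := hU
      exact connectedComponentIn_subset _ _ hz
    exact this.resolve_left (hUpoles z hz)
  have hR0 : 0 < R := by linarith
  have hfz : f z ≠ 0 := by
    rw [← norm_pos_iff]; linarith
  refine ⟨hUR, ?_⟩
  set ζ := Complex.log (f z) with hζ
  obtain ⟨G, hG, hGd, hGζ⟩ := exists_G hR hf hcrit hasym hU hUpoles z hz ζ (Complex.exp_log hfz)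
  have hinj := G_inj hf hcrit hU hUpoles hG hGd
  have hre : ζ.re = Real.log ‖f z‖ := Complex.log_re _
  have hx : Real.log (‖f z‖ / R) = ζ.re - Real.log R := by
    rw [hre, Real.log_div (by linarith) hR0.ne']
  have hx0 : 0 < Real.log (‖f z‖ / R) := Real.log_pos (by rw [lt_div_iff₀ hR0]; linarith)
  have hsub : Metric.ball ζ (Real.log (‖f z‖ / R)) ⊆ {a | Real.log R < a.re} := by
    intro a ha
    rw [mem_ball_iff_norm, hx] at ha
    have := (Complex.abs_re_le_norm (a - ζ)).trans_lt ha
    rw [abs_lt, Complex.sub_re] at this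
    change Real.log R < a.re
    linarith [this.1]
  refine concl_bound hx0 (hGd.mono hsub) (hinj.mono hsub) (fun s hs h => hz₀ (h ▸ (hG s (hsub hs)).1))
    hGζ (hf.1.2.1 z (hUpoles z hz)) ?_
  filter_upwards [Metric.ball_mem_nhds ζ hx0] with s hs
  exact (hG s (hsub hs)).2

/-- Lemma 4.1: bounds on a pole-free component `U` of `{|f| > R}` in terms of
the Schwarzian derivative. -/
theorem schwarzian_lower_bound_on_component
    (R : ℝ) (hR : 1 ≤ R)
    (f : ℂ → ℂ) (Pf : Set ℂ)
    (hf : TranscMeroPlane f Pf)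
    (hcrit : ∀ w : ℂ, some w ∈ CriticalValues f Pf → norm w ≤ R)
    (hasym : ∀ (w : ℂ) (γ : ℝ → ℂ), AsymptoticPath f Pf (some w) γ → norm w ≤ R)
    (U : Set ℂ)
    (hU : IsComponentOf U {z : ℂ | z ∈ Pf ∨ R < norm (f z)})
    (hUpoles : ∀ z ∈ U, z ∉ Pf)
    (z₀ : ℂ) (hz₀ : z₀ ∉ U) :
    ∀ z ∈ U,
      (Real.log (norm (f z) / R)) ^ 2
          ≤ 32 * Real.pi ^ 2 * norm ((z - z₀) ^ 2 * schwarzian f z)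
            + 16 * Real.pi ^ 2 + 12 ∧
      (1 / (2 * R)) * Real.exp (-Real.sqrt
            (32 * Real.pi ^ 2 * norm ((z - z₀) ^ 2 * schwarzian f z)
              + 16 * Real.pi ^ 2 + 12))
        ≤ chordal (some (f z)) none ∧
      (1 / R) * Real.exp
            (-(20 * norm (z - z₀) * Real.sqrt (norm (schwarzian f z))) - 20)
        ≤ (1 / (2 * R)) * Real.exp (-Real.sqrt
            (32 * Real.pi ^ 2 * norm ((z - z₀) ^ 2 * schwarzian f z)
              + 16 * Real.pi ^ 2 + 12)) := by
  intro z hz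
  obtain ⟨h1, h2⟩ := main_bound R hR f Pf hf hcrit hasym U hU hUpoles z₀ hz₀ z hz
  exact ⟨h2, final_ineqs hR h1 (z - z₀) (schwarzian f z) h2⟩

end
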